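/- arXiv:1405.7546 — 3 statements merged into one kernel-verified Lean document; each statement's English description precedes it below -/
import Mathlib

section
/- The relatively free algebra of rank 2 of the variety generated by M_{1,1}(E), namely F₂(M_{1,1}(E)), and the finite-dimensional algebra M_{1,1}^{(2)} satisfy the same polynomial identities: T(F₂(M_{1,1}(E))) = T(M_{1,1}^{(2)}). -/
noncomputable section

/-- `f ∈ K⟨X⟩` (with set of variables `X`) is a polynomial identity of the `K`-algebra `R`:
every substitution of elements of `R` for the variables (i.e. every `K`-algebra homomorphism
from the free algebra to `R`) kills `f`. -/
def IsPI (K : Type) [Field K] {X : Type} (R : Type) [Ring R] [Algebra K R]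
    (f : FreeAlgebra K X) : Prop :=
  ∀ φ : FreeAlgebra K X →ₐ[K] R, φ f = 0

/-- `T(R)`: the set of polynomial identities of `R` inside `K⟨x₁, x₂, …⟩`
(the free unital associative algebra on countably many variables, indexed by `ℕ`). -/
def TId (K : Type) [Field K] (R : Type) [Ring R] [Algebra K R] : Set (FreeAlgebra K ℕ) :=
  {f | IsPI K R f}

/-- A two-sided ideal of `K⟨X⟩` is a T-ideal when it is invariant under all algebra
endomorphisms of `K⟨X⟩`. -/
def IsTIdeal (K : Type) [Field K] (I : TwoSidedIdeal (FreeAlgebra K ℕ)) : Prop :=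
  ∀ φ : FreeAlgebra K ℕ →ₐ[K] FreeAlgebra K ℕ, ∀ f ∈ I, φ f ∈ I

/-- `⟨F⟩^T`: the smallest T-ideal of `K⟨X⟩` containing the set `F`. -/
def TIdealGen (K : Type) [Field K] (F : Set (FreeAlgebra K ℕ)) : Set (FreeAlgebra K ℕ) :=
  {g | ∀ I : TwoSidedIdeal (FreeAlgebra K ℕ), IsTIdeal K I → F ⊆ (I : Set (FreeAlgebra K ℕ)) → g ∈ I}

/-- The commutator `[a, b] = a * b - b * a`. -/
def br {R : Type} [Ring R] (a b : R) : R := a * b - b * a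

/-- The left-normed commutator `[a, b, b, …, b]` with `k` occurrences of `b`. -/
def commPow {R : Type} [Ring R] (a b : R) (k : ℕ) : R := (fun y => br y b)^[k] a

/-- The variable `xᵢ` of `K⟨x₁, x₂, …⟩` (1-based indexing). -/
def xv (K : Type) [Field K] (i : ℕ) : FreeAlgebra K ℕ := FreeAlgebra.ι K i

/-- The product of commutators `[x₁,x₂][x₃,x₄]⋯[x_{2k-1},x_{2k}]`. -/
def chainProd (K : Type) [Field K] (k : ℕ) : FreeAlgebra K ℕ :=
  ((List.range k).map fun i => br (xv K (2 * i + 1)) (xv K (2 * i + 2))).prod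

/-- The Grassmann (exterior) algebra of an infinite dimensional `K`-vector space
with basis `e₁, e₂, …`. -/
abbrev Einf (K : Type) [Field K] : Type := ExteriorAlgebra K (ℕ →₀ K)

/-- The Grassmann (exterior) algebra `E⁽ⁿ⁾` of an `n`-dimensional `K`-vector space. -/
abbrev Efin (K : Type) [Field K] (n : ℕ) : Type := ExteriorAlgebra K (Fin n → K)

/-- The even part `E₀` of the Grassmann algebra of `V`. -/
def evenPart (K V : Type) [Field K] [AddCommGroup V] [Module K V] :
    Submodule K (ExteriorAlgebra K V) :=
  CliffordAlgebra.evenOdd (0 : QuadraticForm K V) 0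

/-- The odd part `E₁` of the Grassmann algebra of `V`. -/
def oddPart (K V : Type) [Field K] [AddCommGroup V] [Module K V] :
    Submodule K (ExteriorAlgebra K V) :=
  CliffordAlgebra.evenOdd (0 : QuadraticForm K V) 1

section matrixAlgebras

variable (K V : Type) [Field K] [AddCommGroup V] [Module K V]

private theorem evenPart_mul_mem {a b : ExteriorAlgebra K V}
    (ha : a ∈ evenPart K V) (hb : b ∈ evenPart K V) : a * b ∈ evenPart K V := by
  have := CliffordAlgebra.evenOdd_mul_le (Q := (0 : QuadraticForm K V)) 0 0
    (Submodule.mul_mem_mul ha hb)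
  simpa [evenPart] using this

private theorem evenPart_one_mem : (1 : ExteriorAlgebra K V) ∈ evenPart K V :=
  SetLike.one_mem_graded _

private theorem evenPart_algebraMap_mem (c : K) :
    algebraMap K (ExteriorAlgebra K V) c ∈ evenPart K V :=
  SetLike.algebraMap_mem_graded _ c

/-- The algebra `A` (over the Grassmann algebra of `V`): the subalgebra of `2 × 2`
matrices over `E = Λ(V)` whose `(1,1)` entry lies in `E₀`, whose `(2,1)` entry is `0`,
and whose `(1,2)` and `(2,2)` entries are arbitrary. -/
def algA : Subalgebra K (Matrix (Fin 2) (Fin 2) (ExteriorAlgebra K V)) where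
  carrier := {M | M 0 0 ∈ evenPart K V ∧ M 1 0 = 0}
  mul_mem' := by
    rintro a b ⟨ha0, ha1⟩ ⟨hb0, hb1⟩
    refine ⟨?_, ?_⟩
    · have h : (a * b) 0 0 = a 0 0 * b 0 0 + a 0 1 * b 1 0 := by
        simp [Matrix.mul_apply, Fin.sum_univ_two]
      rw [h, hb1, mul_zero, add_zero]
      exact evenPart_mul_mem K V ha0 hb0
    · have h : (a * b) 1 0 = a 1 0 * b 0 0 + a 1 1 * b 1 0 := by
        simp [Matrix.mul_apply, Fin.sum_univ_two]
      rw [h, ha1, hb1, zero_mul, mul_zero, add_zero]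
  one_mem' := by
    refine ⟨?_, ?_⟩
    · rw [Matrix.one_apply_eq]; exact evenPart_one_mem K V
    · exact Matrix.one_apply_ne (by decide)
  add_mem' := by
    rintro a b ⟨ha0, ha1⟩ ⟨hb0, hb1⟩
    exact ⟨Submodule.add_mem _ ha0 hb0, by simp [ha1, hb1]⟩
  zero_mem' := ⟨Submodule.zero_mem _, rfl⟩
  algebraMap_mem' := fun c => by
    refine ⟨?_, ?_⟩
    · rw [Matrix.algebraMap_matrix_apply, if_pos rfl]
      exact evenPart_algebraMap_mem K V c
    · rw [Matrix.algebraMap_matrix_apply, if_neg (by decide)]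

end matrixAlgebras

section matrixAlgebras2

variable (K V : Type) [Field K] [AddCommGroup V] [Module K V]

private theorem oddPart_mul_mem_even {a b : ExteriorAlgebra K V}
    (ha : a ∈ oddPart K V) (hb : b ∈ oddPart K V) : a * b ∈ evenPart K V := by
  have := CliffordAlgebra.evenOdd_mul_le (Q := (0 : QuadraticForm K V)) 1 1
    (Submodule.mul_mem_mul ha hb)
  have h2 : ((1 : ZMod 2) + 1) = 0 := by decide
  rw [h2] at this
  exact this

private theorem even_mul_odd_mem {a b : ExteriorAlgebra K V}
    (ha : a ∈ evenPart K V) (hb : b ∈ oddPart K V) : a * b ∈ oddPart K V := by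
  have := CliffordAlgebra.evenOdd_mul_le (Q := (0 : QuadraticForm K V)) 0 1
    (Submodule.mul_mem_mul ha hb)
  rw [zero_add] at this
  exact this

private theorem odd_mul_even_mem {a b : ExteriorAlgebra K V}
    (ha : a ∈ oddPart K V) (hb : b ∈ evenPart K V) : a * b ∈ oddPart K V := by
  have := CliffordAlgebra.evenOdd_mul_le (Q := (0 : QuadraticForm K V)) 1 0
    (Submodule.mul_mem_mul ha hb)
  rw [add_zero] at this
  exact this

/-- The algebra `A′` (over the Grassmann algebra of `V`): the subalgebra of `2 × 2`
matrices over `E = Λ(V)` whose `(2,2)` entry lies in `E₀`, whose `(2,1)` entry is `0`,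
and whose `(1,1)` and `(1,2)` entries are arbitrary. -/
def algA' : Subalgebra K (Matrix (Fin 2) (Fin 2) (ExteriorAlgebra K V)) where
  carrier := {M | M 1 1 ∈ evenPart K V ∧ M 1 0 = 0}
  mul_mem' := by
    rintro a b ⟨ha0, ha1⟩ ⟨hb0, hb1⟩
    refine ⟨?_, ?_⟩
    · have h : (a * b) 1 1 = a 1 0 * b 0 1 + a 1 1 * b 1 1 := by
        simp [Matrix.mul_apply, Fin.sum_univ_two]
      rw [h, ha1, zero_mul, zero_add]
      exact evenPart_mul_mem K V ha0 hb0
    · have h : (a * b) 1 0 = a 1 0 * b 0 0 + a 1 1 * b 1 0 := by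
        simp [Matrix.mul_apply, Fin.sum_univ_two]
      rw [h, ha1, hb1, zero_mul, mul_zero, add_zero]
  one_mem' := by
    refine ⟨?_, ?_⟩
    · rw [Matrix.one_apply_eq]; exact evenPart_one_mem K V
    · exact Matrix.one_apply_ne (by decide)
  add_mem' := by
    rintro a b ⟨ha0, ha1⟩ ⟨hb0, hb1⟩
    exact ⟨Submodule.add_mem _ ha0 hb0, by simp [ha1, hb1]⟩
  zero_mem' := ⟨Submodule.zero_mem _, rfl⟩
  algebraMap_mem' := fun c => by
    refine ⟨?_, ?_⟩
    · rw [Matrix.algebraMap_matrix_apply, if_pos rfl]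
      exact evenPart_algebraMap_mem K V c
    · rw [Matrix.algebraMap_matrix_apply, if_neg (by decide)]

/-- The algebra `M_{1,1}` (over the Grassmann algebra of `V`): the subalgebra of `2 × 2`
matrices over `E = Λ(V)` whose diagonal entries lie in `E₀` and whose off-diagonal entries
lie in `E₁`. -/
def m11 : Subalgebra K (Matrix (Fin 2) (Fin 2) (ExteriorAlgebra K V)) where
  carrier := {M | M 0 0 ∈ evenPart K V ∧ M 1 1 ∈ evenPart K V ∧
    M 0 1 ∈ oddPart K V ∧ M 1 0 ∈ oddPart K V}
  mul_mem' := by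
    rintro a b ⟨ha00, ha11, ha01, ha10⟩ ⟨hb00, hb11, hb01, hb10⟩
    have h00 : (a * b) 0 0 = a 0 0 * b 0 0 + a 0 1 * b 1 0 := by
      simp [Matrix.mul_apply, Fin.sum_univ_two]
    have h11 : (a * b) 1 1 = a 1 0 * b 0 1 + a 1 1 * b 1 1 := by
      simp [Matrix.mul_apply, Fin.sum_univ_two]
    have h01 : (a * b) 0 1 = a 0 0 * b 0 1 + a 0 1 * b 1 1 := by
      simp [Matrix.mul_apply, Fin.sum_univ_two]
    have h10 : (a * b) 1 0 = a 1 0 * b 0 0 + a 1 1 * b 1 0 := by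
      simp [Matrix.mul_apply, Fin.sum_univ_two]
    refine ⟨?_, ?_, ?_, ?_⟩
    · rw [h00]
      exact Submodule.add_mem _ (evenPart_mul_mem K V ha00 hb00)
        (oddPart_mul_mem_even K V ha01 hb10)
    · rw [h11]
      exact Submodule.add_mem _ (oddPart_mul_mem_even K V ha10 hb01)
        (evenPart_mul_mem K V ha11 hb11)
    · rw [h01]
      exact Submodule.add_mem _ (even_mul_odd_mem K V ha00 hb01)
        (odd_mul_even_mem K V ha01 hb11)
    · rw [h10]
      exact Submodule.add_mem _ (odd_mul_even_mem K V ha10 hb00)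
        (even_mul_odd_mem K V ha11 hb10)
  one_mem' := by
    refine ⟨?_, ?_, ?_, ?_⟩
    · rw [Matrix.one_apply_eq]; exact evenPart_one_mem K V
    · rw [Matrix.one_apply_eq]; exact evenPart_one_mem K V
    · rw [Matrix.one_apply_ne (by decide)]; exact Submodule.zero_mem _
    · rw [Matrix.one_apply_ne (by decide)]; exact Submodule.zero_mem _
  add_mem' := by
    rintro a b ⟨ha00, ha11, ha01, ha10⟩ ⟨hb00, hb11, hb01, hb10⟩
    exact ⟨Submodule.add_mem _ ha00 hb00, Submodule.add_mem _ ha11 hb11,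
      Submodule.add_mem _ ha01 hb01, Submodule.add_mem _ ha10 hb10⟩
  zero_mem' := ⟨Submodule.zero_mem _, Submodule.zero_mem _,
    Submodule.zero_mem _, Submodule.zero_mem _⟩
  algebraMap_mem' := fun c => by
    refine ⟨?_, ?_, ?_, ?_⟩
    · rw [Matrix.algebraMap_matrix_apply, if_pos rfl]
      exact evenPart_algebraMap_mem K V c
    · rw [Matrix.algebraMap_matrix_apply, if_pos rfl]
      exact evenPart_algebraMap_mem K V c
    · rw [Matrix.algebraMap_matrix_apply, if_neg (by decide)]
      exact Submodule.zero_mem _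
    · rw [Matrix.algebraMap_matrix_apply, if_neg (by decide)]
      exact Submodule.zero_mem _

end matrixAlgebras2

/-- The relatively free algebra `F_n(R) = K⟨x₁, …, xₙ⟩ / (K⟨x₁, …, xₙ⟩ ∩ T(R))` of rank `n`
of the variety generated by `R`: the quotient of the free algebra on `n` variables by the
ideal of polynomial identities of `R` in those variables. -/
abbrev RelFree (K : Type) [Field K] (R : Type) [Ring R] [Algebra K R] (n : ℕ) : Type :=
  RingQuot (fun f g : FreeAlgebra K (Fin n) => IsPI K R (f - g))

end

section PolynomialIdentities

open scoped TensorProduct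

/-- `f` is an identity of `F_n(R)` exactly when it vanishes on all subalgebras of `R` generated
by `n` elements. -/
theorem mem_TId_relFree_iff {K : Type} [Field K] {R : Type} [Ring R] [Algebra K R] {n : ℕ}
    {f : FreeAlgebra K ℕ} :
    f ∈ TId K (RelFree K R n) ↔
      ∀ (φ : FreeAlgebra K ℕ →ₐ[K] FreeAlgebra K (Fin n)) (ψ : FreeAlgebra K (Fin n) →ₐ[K] R),
        ψ (φ f) = 0 := by
  set r := fun f g : FreeAlgebra K (Fin n) => IsPI K R (f - g) with hr
  constructor
  · intro hf φ ψ
    have h := hf ((RingQuot.mkAlgHom K r).comp φ)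
    have hw : ∀ ⦃x y⦄, r x y → ψ x = ψ y := fun x y hxy => by
      simpa [sub_eq_zero] using hxy ψ
    rw [← RingQuot.liftAlgHom_mkAlgHom_apply K ψ hw]
    rw [AlgHom.comp_apply] at h
    rw [h, map_zero]
  · intro h Φ
    choose g hg using fun i => RingQuot.mkAlgHom_surjective K r (Φ (FreeAlgebra.ι K i))
    have hΦ : Φ = (RingQuot.mkAlgHom K r).comp (FreeAlgebra.lift K g) := by
      ext i
      simp [hg]
    have hrel : r (FreeAlgebra.lift K g f) 0 := fun ψ => by
      rw [sub_zero]
      exact h _ ψ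
    rw [hΦ, AlgHom.comp_apply, RingQuot.mkAlgHom_rel K hrel, map_zero]

theorem eq_zero_of_forall_eval_eq_zero {K V σ : Type} [Field K] [Infinite K] [AddCommGroup V]
    [Module K V] (d : MvPolynomial σ K) (hd : d ≠ 0) (z : V ⊗[K] MvPolynomial σ K)
    (hz : ∀ c : σ → K, MvPolynomial.eval c d ≠ 0 →
      LinearMap.lTensor V (MvPolynomial.aeval c).toLinearMap z = 0) : z = 0 := by
  classical
  let b := Module.Basis.ofVectorSpace K V
  let e := TensorProduct.equivFinsuppOfBasisLeft (N := MvPolynomial σ K) b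
  have key : ∀ (c : σ → K) (z : V ⊗[K] MvPolynomial σ K) (i),
      TensorProduct.equivFinsuppOfBasisLeft b
        (LinearMap.lTensor V (MvPolynomial.aeval c).toLinearMap z) i
        = MvPolynomial.eval c (e z i) := by
    intro c z i
    induction z with
    | zero => simp
    | add x y hx hy => simp only [map_add, Finsupp.add_apply, hx, hy]
    | tmul v p => simp [e, MvPolynomial.smul_eval]
  apply e.injective
  rw [map_zero]
  ext1 i
  have h0 : d * e z i = 0 := by
    apply MvPolynomial.funext
    intro c
    by_cases hc : MvPolynomial.eval c d = 0
    · simp [hc]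
    · rw [map_mul, ← key, hz c hc]
      simp
  exact (mul_eq_zero.mp h0).resolve_left hd

/-- Identities over an infinite field are stable under commutative extensions of scalars. -/
theorem IsPI.tensorProduct {K X R A : Type} [Field K] [Infinite K] [Ring R] [Algebra K R]
    [CommRing A] [Algebra K A] {f : FreeAlgebra K X} (hf : IsPI K R f) :
    IsPI K (R ⊗[K] A) f := by
  intro φ
  let π : MvPolynomial A K →ₐ[K] A := MvPolynomial.aeval id
  have hπ : Function.Surjective π := fun a => ⟨MvPolynomial.X a, by simp [π]⟩
  let πR : R ⊗[K] MvPolynomial A K →ₐ[K] R ⊗[K] A := Algebra.TensorProduct.map (AlgHom.id K R) π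
  have hπR : Function.Surjective πR := by
    have := LinearMap.lTensor_surjective R (g := π.toLinearMap) hπ
    exact this
  choose g hg using fun i => hπR (φ (FreeAlgebra.ι K i))
  have hφ : φ = πR.comp (FreeAlgebra.lift K g) := by
    ext i
    simp [hg]
  have h0 : FreeAlgebra.lift K g f = 0 := by
    refine eq_zero_of_forall_eval_eq_zero 1 one_ne_zero _ fun c _ => ?_
    let ev : R ⊗[K] MvPolynomial A K →ₐ[K] R ⊗[K] K :=
      Algebra.TensorProduct.map (AlgHom.id K R) (MvPolynomial.aeval c)
    have h1 := hf (((Algebra.TensorProduct.rid K K R).toAlgHom.comp ev).comp (FreeAlgebra.lift K g))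
    exact (Algebra.TensorProduct.rid K K R).injective (h1.trans (map_zero _).symm)
  rw [hφ, AlgHom.comp_apply, h0, map_zero]

theorem lift_eq_zero_of_perturbation {K X R : Type} [Field K] [Infinite K] [Ring R] [Algebra K R]
    (x d : X → R) (t₀ : K) (f : FreeAlgebra K X)
    (h : ∀ t : K, t ≠ t₀ → FreeAlgebra.lift K (x + t • d) f = 0) :
    FreeAlgebra.lift K x f = 0 := by
  let T : MvPolynomial Unit K := MvPolynomial.X ()
  let F : FreeAlgebra K X →ₐ[K] R ⊗[K] MvPolynomial Unit K :=
    FreeAlgebra.lift K fun i => x i ⊗ₜ 1 + d i ⊗ₜ T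
  let ev (c : Unit → K) : R ⊗[K] MvPolynomial Unit K →ₐ[K] R ⊗[K] K :=
    Algebra.TensorProduct.map (AlgHom.id K R) (MvPolynomial.aeval c)
  have hev : ∀ c : Unit → K, (((Algebra.TensorProduct.rid K K R).toAlgHom.comp (ev c)).comp F)
      = FreeAlgebra.lift K (x + c () • d) := by
    intro c
    ext i
    simp [F, ev, T]
  have h0 : F f = 0 := by
    refine eq_zero_of_forall_eval_eq_zero (T - MvPolynomial.C t₀) ?_ _ fun c hc => ?_
    · intro h0
      have := congrArg (MvPolynomial.eval fun _ => t₀ + 1) h0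
      simp [T] at this
    · have h1 := h (c ()) (by simpa [T, sub_eq_zero] using hc)
      rw [← hev c] at h1
      exact (Algebra.TensorProduct.rid K K R).injective (h1.trans (map_zero _).symm)
  have h1 := congrArg (fun φ => φ f) (hev 0)
  simp only [AlgHom.comp_apply, h0, map_zero] at h1
  simpa using h1.symm

end PolynomialIdentities

section ExteriorParity

variable {K V W : Type} [Field K] [AddCommGroup V] [Module K V] [AddCommGroup W] [Module K W]

theorem ι_mem_oddPart (v : V) : ExteriorAlgebra.ι K v ∈ oddPart K V :=
  CliffordAlgebra.ι_mem_evenOdd_one _ v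

@[elab_as_elim]
theorem evenPart_induction {P : ∀ x : ExteriorAlgebra K V, x ∈ evenPart K V → Prop}
    (algebraMap : ∀ r h, P (algebraMap K _ r) h)
    (add : ∀ x y hx hy, P x hx → P y hy → ∀ h, P (x + y) h)
    (ι_mul : ∀ v w x hx, P x hx →
      ∀ h, P (ExteriorAlgebra.ι K v * ExteriorAlgebra.ι K w * x) h)
    {x : ExteriorAlgebra K V} (hx : x ∈ evenPart K V) : P x hx :=
  CliffordAlgebra.even_induction (Q := (0 : QuadraticForm K V)) (motive := P)
    (fun r => algebraMap r _) (fun x y hx hy px py => add x y hx hy px py _)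
    (fun v w x hx px => ι_mul v w x hx px _) x hx

@[elab_as_elim]
theorem oddPart_induction {P : ∀ x : ExteriorAlgebra K V, x ∈ oddPart K V → Prop}
    (ι : ∀ v h, P (ExteriorAlgebra.ι K v) h)
    (add : ∀ x y hx hy, P x hx → P y hy → ∀ h, P (x + y) h)
    (ι_mul : ∀ v w x hx, P x hx →
      ∀ h, P (ExteriorAlgebra.ι K v * ExteriorAlgebra.ι K w * x) h)
    {x : ExteriorAlgebra K V} (hx : x ∈ oddPart K V) : P x hx :=
  CliffordAlgebra.odd_induction (Q := (0 : QuadraticForm K V)) (P := P)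
    (fun v => ι v _) (fun x y hx hy px py => add x y hx hy px py _)
    (fun v w x hx px => ι_mul v w x hx px _) x hx

theorem ι_mul_ι_anticomm (v w : V) :
    ExteriorAlgebra.ι K v * ExteriorAlgebra.ι K w
      = -(ExteriorAlgebra.ι K w * ExteriorAlgebra.ι K v) :=
  eq_neg_of_add_eq_zero_left (ExteriorAlgebra.ι_add_mul_swap v w)

theorem commute_ι_mul_ι (v w : V) (x : ExteriorAlgebra K V) :
    Commute (ExteriorAlgebra.ι K v * ExteriorAlgebra.ι K w) x := by
  induction x using ExteriorAlgebra.induction with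
  | algebraMap r => exact Algebra.commutes' r _ |>.symm
  | ι u =>
    rw [commute_iff_eq, mul_assoc, ι_mul_ι_anticomm w u, mul_neg, ← mul_assoc,
      ι_mul_ι_anticomm v u, neg_mul, neg_neg, mul_assoc]
  | mul a b ha hb => exact ha.mul_right hb
  | add a b ha hb => exact ha.add_right hb

theorem commute_of_mem_evenPart {x : ExteriorAlgebra K V} (hx : x ∈ evenPart K V)
    (y : ExteriorAlgebra K V) : Commute x y := by
  induction hx using evenPart_induction with
  | algebraMap r => exact Algebra.commutes' r _
  | add a b _ _ ha hb => exact ha.add_left hb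
  | ι_mul v w a _ ha => exact (commute_ι_mul_ι v w y).mul_left ha

theorem mul_anticomm_of_mem_oddPart {x y : ExteriorAlgebra K V} (hx : x ∈ oddPart K V)
    (hy : y ∈ oddPart K V) : x * y = -(y * x) := by
  induction hx using oddPart_induction with
  | add a b _ _ ha hb => rw [add_mul, mul_add, ha, hb, neg_add]
  | ι_mul v w a _ ha =>
    rw [mul_assoc, ha, mul_neg, ← mul_assoc, (commute_ι_mul_ι v w y).eq, mul_assoc]
  | ι v =>
    induction hy using oddPart_induction with
    | ι w => exact ι_mul_ι_anticomm v w
    | add a b _ _ ha hb => rw [add_mul, mul_add, ha, hb, neg_add]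
    | ι_mul u w a _ ha =>
      rw [← mul_assoc, ← (commute_ι_mul_ι u w _).eq, mul_assoc, ha, mul_neg, ← mul_assoc]

theorem mul_self_of_mem_oddPart [CharZero K] {x : ExteriorAlgebra K V} (hx : x ∈ oddPart K V) :
    x * x = 0 := by
  have h := mul_anticomm_of_mem_oddPart hx hx
  have h2 : (2 : K) • (x * x) = 0 := by
    rw [two_smul]
    exact add_eq_zero_iff_eq_neg.mpr h
  exact (smul_eq_zero.mp h2).resolve_left two_ne_zero

/-- The body of an even element `x`: the scalar `c` with `x - c` nilpotent. -/
theorem exists_isNilpotent_sub_algebraMap {x : ExteriorAlgebra K V} (hx : x ∈ evenPart K V) :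
    ∃ c : K, IsNilpotent (x - algebraMap K _ c) := by
  induction hx using evenPart_induction with
  | algebraMap r => exact ⟨r, by simp⟩
  | add a b ha _ hc hd =>
    obtain ⟨c, hc⟩ := hc
    obtain ⟨d, hd⟩ := hd
    refine ⟨c + d, ?_⟩
    rw [map_add, add_sub_add_comm]
    exact ((commute_of_mem_evenPart ha _).sub_left (Algebra.commutes' c _)).isNilpotent_add hc hd
  | ι_mul v w a _ _ =>
    refine ⟨0, 2, ?_⟩
    have h0 : ExteriorAlgebra.ι K w * (ExteriorAlgebra.ι K v * ExteriorAlgebra.ι K w) = 0 := by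
      rw [ι_mul_ι_anticomm v w, mul_neg, ← mul_assoc, ExteriorAlgebra.ι_sq_zero, zero_mul, neg_zero]
    rw [map_zero, sub_zero, (commute_ι_mul_ι v w a).mul_pow, pow_two, mul_assoc, mul_assoc,
      ← mul_assoc _ _ (a ^ 2), ← mul_assoc _ _ (a ^ 2), h0, mul_zero, zero_mul]

theorem exists_evenPart_mul_eq_one {x : ExteriorAlgebra K V} (hx : x ∈ evenPart K V) :
    ∃ c : K, ∀ t : K, t ≠ c →
      ∃ b ∈ evenPart K V, b * (x + algebraMap K _ t) = 1 := by
  obtain ⟨c, hc⟩ := exists_isNilpotent_sub_algebraMap hx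
  refine ⟨-c, fun t ht => ?_⟩
  let S := CliffordAlgebra.even (0 : QuadraticForm K V)
  let n : S := ⟨x, hx⟩ - algebraMap K S c
  have hn : IsNilpotent n := by
    obtain ⟨k, hk⟩ := hc
    exact ⟨k, Subtype.ext hk⟩
  have hu : IsUnit (algebraMap K S (t + c)) := by
    refine (IsUnit.mk0 _ fun h => ht ?_).map _
    exact eq_neg_of_add_eq_zero_left h
  have h := hn.isUnit_add_left_of_commute hu (Algebra.commutes _ _).symm
  obtain ⟨b, hb⟩ := h.exists_left_inv
  refine ⟨b, b.2, ?_⟩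
  have hb' := congrArg (Subtype.val : S → ExteriorAlgebra K V) hb
  refine Eq.trans ?_ hb'
  change (b : ExteriorAlgebra K V) * _ = b * (algebraMap K _ (t + c) + (x - algebraMap K _ c))
  rw [map_add]
  congr 1
  abel

theorem map_mem_parts (F : ExteriorAlgebra K V →ₐ[K] ExteriorAlgebra K W)
    (hF : ∀ v, F (ExteriorAlgebra.ι K v) ∈ oddPart K W) :
    (∀ x ∈ evenPart K V, F x ∈ evenPart K W) ∧ (∀ x ∈ oddPart K V, F x ∈ oddPart K W) := by
  constructor
  · intro x hx
    induction hx using evenPart_induction with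
    | algebraMap r =>
      rw [AlgHom.commutes]
      exact evenPart_algebraMap_mem K W r
    | add a b _ _ ha hb =>
      rw [map_add]
      exact add_mem ha hb
    | ι_mul v w a _ ha =>
      rw [map_mul, map_mul]
      exact evenPart_mul_mem K W (oddPart_mul_mem_even K W (hF v) (hF w)) ha
  · intro x hx
    induction hx using oddPart_induction with
    | ι v => exact hF v
    | add a b _ _ ha hb =>
      rw [map_add]
      exact add_mem ha hb
    | ι_mul v w a _ ha =>
      rw [map_mul, map_mul]
      exact even_mul_odd_mem K W (oddPart_mul_mem_even K W (hF v) (hF w)) ha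

/-- The homomorphism `M_{1,1}(Λ V) → M_{1,1}(Λ W)` induced by a parity preserving homomorphism
`Λ V → Λ W`. -/
def m11Map (F : ExteriorAlgebra K V →ₐ[K] ExteriorAlgebra K W)
    (hF : ∀ v, F (ExteriorAlgebra.ι K v) ∈ oddPart K W) : m11 K V →ₐ[K] m11 K W :=
  (F.mapMatrix.comp (m11 K V).val).codRestrict (m11 K W) fun M =>
    have h := map_mem_parts F hF
    ⟨h.1 _ M.2.1, h.1 _ M.2.2.1, h.2 _ M.2.2.2.1, h.2 _ M.2.2.2.2⟩

theorem m11Map_apply (F : ExteriorAlgebra K V →ₐ[K] ExteriorAlgebra K W)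
    (hF : ∀ v, F (ExteriorAlgebra.ι K v) ∈ oddPart K W) (M : m11 K V) :
    (m11Map F hF M : Matrix (Fin 2) (Fin 2) (ExteriorAlgebra K W)) = M.1.map F :=
  rfl

end ExteriorParity

section TwoGenerators

variable {K : Type} [Field K]

/-- The generator `eᵢ` of the Grassmann algebra of a 2-dimensional vector space. -/
def grassGen (K : Type) [Field K] (i : Fin 2) : Efin K 2 :=
  ExteriorAlgebra.ι K (Pi.single i 1)

/-- The general element of `M_{1,1}^{(2)}` in coordinates. -/
def grassMat (p₀ p₁ u₁ u₂ v₁ v₂ q₀ q₁ : K) : Matrix (Fin 2) (Fin 2) (Efin K 2) :=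
  !![p₀ • 1 + p₁ • (grassGen K 0 * grassGen K 1), u₁ • grassGen K 0 + u₂ • grassGen K 1;
     v₁ • grassGen K 0 + v₂ • grassGen K 1, q₀ • 1 + q₁ • (grassGen K 0 * grassGen K 1)]

theorem grassGen_sq (i : Fin 2) : grassGen K i * grassGen K i = 0 :=
  ExteriorAlgebra.ι_sq_zero _

theorem grassGen_swap : grassGen K 1 * grassGen K 0 = -(grassGen K 0 * grassGen K 1) :=
  ι_mul_ι_anticomm _ _

theorem ι_eq_grassGen (v : Fin 2 → K) :
    ExteriorAlgebra.ι K v = v 0 • grassGen K 0 + v 1 • grassGen K 1 := by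
  rw [grassGen, grassGen, ← map_smul, ← map_smul, ← map_add]
  congr 1
  ext i
  fin_cases i <;> simp

theorem grassMat_mul (p₀ p₁ u₁ u₂ v₁ v₂ q₀ q₁ p₀' p₁' u₁' u₂' v₁' v₂' q₀' q₁' : K) :
    grassMat p₀ p₁ u₁ u₂ v₁ v₂ q₀ q₁ * grassMat p₀' p₁' u₁' u₂' v₁' v₂' q₀' q₁' =
      grassMat (p₀ * p₀') (p₀ * p₁' + p₁ * p₀' + (u₁ * v₂' - u₂ * v₁'))
        (p₀ * u₁' + u₁ * q₀') (p₀ * u₂' + u₂ * q₀') (v₁ * p₀' + q₀ * v₁') (v₂ * p₀' + q₀ * v₂')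
        (q₀ * q₀') (q₀ * q₁' + q₁ * q₀' + (v₁ * u₂' - v₂ * u₁')) := by
  have h11 := grassGen_sq (K := K) 0
  have h22 := grassGen_sq (K := K) 1
  have h21 := grassGen_swap (K := K)
  unfold grassMat
  generalize grassGen K 0 = a at *
  generalize grassGen K 1 = b at *
  have h1 : a * (a * b) = 0 := by rw [← mul_assoc, h11, zero_mul]
  have h2 : b * (a * b) = 0 := by rw [← mul_assoc, h21, neg_mul, mul_assoc, h22, mul_zero, neg_zero]
  have h3 : a * b * a = 0 := by rw [mul_assoc, h21, mul_neg, h1, neg_zero]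
  have h4 : a * b * b = 0 := by rw [mul_assoc, h22, mul_zero]
  have h5 : a * b * (a * b) = 0 := by rw [← mul_assoc, h3, zero_mul]
  rw [Matrix.mul_fin_two]
  congr 1
  simp only [mul_add, add_mul, smul_mul_smul_comm, mul_one, one_mul, h11, h22, h21, h1, h2, h3, h4,
    h5, smul_zero, add_zero, zero_add]
  congr 1
  · congr 1
    · module
    · congr 1
      module
  · congr 1
    congr 1
    · module
    · congr 1
      module

theorem grassMat_add (p₀ p₁ u₁ u₂ v₁ v₂ q₀ q₁ p₀' p₁' u₁' u₂' v₁' v₂' q₀' q₁' : K) :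
    grassMat p₀ p₁ u₁ u₂ v₁ v₂ q₀ q₁ + grassMat p₀' p₁' u₁' u₂' v₁' v₂' q₀' q₁' =
      grassMat (p₀ + p₀') (p₁ + p₁') (u₁ + u₁') (u₂ + u₂') (v₁ + v₁') (v₂ + v₂')
        (q₀ + q₀') (q₁ + q₁') := by
  unfold grassMat
  ext i j
  fin_cases i <;> fin_cases j <;> simp <;> module

theorem smul_grassMat (c p₀ p₁ u₁ u₂ v₁ v₂ q₀ q₁ : K) :
    c • grassMat p₀ p₁ u₁ u₂ v₁ v₂ q₀ q₁ =
      grassMat (c * p₀) (c * p₁) (c * u₁) (c * u₂) (c * v₁) (c * v₂) (c * q₀) (c * q₁) := by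
  unfold grassMat
  ext i j
  fin_cases i <;> fin_cases j <;> simp <;> module

theorem grassMat_one : grassMat (1 : K) 0 0 0 0 0 1 0 = 1 := by
  unfold grassMat
  ext i j
  fin_cases i <;> fin_cases j <;> simp

theorem grassMat_mem (p₀ p₁ u₁ u₂ v₁ v₂ q₀ q₁ : K) :
    grassMat p₀ p₁ u₁ u₂ v₁ v₂ q₀ q₁ ∈ m11 K (Fin 2 → K) := by
  have hw : grassGen K 0 * grassGen K 1 ∈ evenPart K (Fin 2 → K) :=
    oddPart_mul_mem_even K _ (ι_mem_oddPart _) (ι_mem_oddPart _)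
  have hg : ∀ i, grassGen K i ∈ oddPart K (Fin 2 → K) := fun i => ι_mem_oddPart _
  have he : ∀ c d : K, c • 1 + d • (grassGen K 0 * grassGen K 1) ∈ evenPart K (Fin 2 → K) :=
    fun c d => add_mem (Submodule.smul_mem _ _ (evenPart_one_mem K _)) (Submodule.smul_mem _ _ hw)
  have ho : ∀ c d : K, c • grassGen K 0 + d • grassGen K 1 ∈ oddPart K (Fin 2 → K) :=
    fun c d => add_mem (Submodule.smul_mem _ _ (hg 0)) (Submodule.smul_mem _ _ (hg 1))
  exact ⟨he _ _, he _ _, ho _ _, ho _ _⟩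

theorem exists_of_mem_evenPart_two {x : Efin K 2} (hx : x ∈ evenPart K (Fin 2 → K)) :
    ∃ c d : K, x = c • 1 + d • (grassGen K 0 * grassGen K 1) := by
  induction hx using evenPart_induction with
  | algebraMap r => exact ⟨r, 0, by simp [Algebra.algebraMap_eq_smul_one]⟩
  | add x y _ _ hx hy =>
    obtain ⟨c, d, rfl⟩ := hx
    obtain ⟨c', d', rfl⟩ := hy
    exact ⟨c + c', d + d', by module⟩
  | ι_mul v w x _ hx =>
    obtain ⟨c, d, rfl⟩ := hx
    refine ⟨0, (v 0 * w 1 - v 1 * w 0) * c, ?_⟩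
    have h := congrFun (congrFun (grassMat_mul 0 0 (v 0) (v 1) 0 0 0 0 0 0 0 0 (w 0) (w 1) 0 0) 0) 0
    have h' := congrFun (congrFun (grassMat_mul 0 (v 0 * w 1 - v 1 * w 0) 0 0 0 0 0 0
      c d 0 0 0 0 0 0) 0) 0
    simp [grassMat] at h h'
    rw [ι_eq_grassGen, ι_eq_grassGen, h, zero_smul, zero_add, smul_mul_assoc, h']

theorem exists_of_mem_oddPart_two {x : Efin K 2} (hx : x ∈ oddPart K (Fin 2 → K)) :
    ∃ c d : K, x = c • grassGen K 0 + d • grassGen K 1 := by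
  induction hx using oddPart_induction with
  | ι v => exact ⟨v 0, v 1, ι_eq_grassGen v⟩
  | add x y _ _ hx hy =>
    obtain ⟨c, d, rfl⟩ := hx
    obtain ⟨c', d', rfl⟩ := hy
    exact ⟨c + c', d + d', by module⟩
  | ι_mul v w x _ hx =>
    obtain ⟨c, d, rfl⟩ := hx
    refine ⟨0, 0, ?_⟩
    have h := congrFun (congrFun (grassMat_mul 0 0 (v 0) (v 1) 0 0 0 0 0 0 0 0 (w 0) (w 1) 0 0) 0) 0
    have h' := congrFun (congrFun (grassMat_mul 0 1 0 0 0 0 0 0 0 0 c d 0 0 0 0) 0) 1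
    simp [grassMat] at h h'
    rw [ι_eq_grassGen, ι_eq_grassGen, h, smul_mul_assoc, h']
    simp

theorem exists_eq_grassMat {M : Matrix (Fin 2) (Fin 2) (Efin K 2)} (hM : M ∈ m11 K (Fin 2 → K)) :
    ∃ p₀ p₁ u₁ u₂ v₁ v₂ q₀ q₁ : K, M = grassMat p₀ p₁ u₁ u₂ v₁ v₂ q₀ q₁ := by
  obtain ⟨h00, h11, h01, h10⟩ := hM
  obtain ⟨p₀, p₁, hp⟩ := exists_of_mem_evenPart_two h00
  obtain ⟨q₀, q₁, hq⟩ := exists_of_mem_evenPart_two h11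
  obtain ⟨u₁, u₂, hu⟩ := exists_of_mem_oddPart_two h01
  obtain ⟨v₁, v₂, hv⟩ := exists_of_mem_oddPart_two h10
  exact ⟨p₀, p₁, u₁, u₂, v₁, v₂, q₀, q₁, by
    rw [Matrix.eta_fin_two M, hp, hq, hu, hv, grassMat]⟩

/-- If all 2-generated subalgebras of `M_{1,1}^{(2)}` satisfy `f`, then so does `M_{1,1}^{(2)}`:
it is a subquotient of the product of the two subalgebras in which one off-diagonal
entry is a multiple of `e₁` and the other one a multiple of `e₂`. -/
theorem isPI_m11_two_of_two_generated {f : FreeAlgebra K ℕ}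
    (h : ∀ (φ : FreeAlgebra K ℕ →ₐ[K] FreeAlgebra K (Fin 2))
      (ψ : FreeAlgebra K (Fin 2) →ₐ[K] m11 K (Fin 2 → K)), ψ (φ f) = 0) :
    IsPI K (m11 K (Fin 2 → K)) f := by
  intro Φ
  choose p₀ p₁ u₁ u₂ v₁ v₂ q₀ q₁ hΦ using
    fun i => exists_eq_grassMat (Φ (FreeAlgebra.ι K i)).2
  let X : FreeAlgebra K (Fin 2) := FreeAlgebra.ι K 0
  let Y : FreeAlgebra K (Fin 2) := FreeAlgebra.ι K 1
  let φ : FreeAlgebra K ℕ →ₐ[K] FreeAlgebra K (Fin 2) := FreeAlgebra.lift K fun i =>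
    p₀ i • X + p₁ i • (X * (Y * Y)) + u₁ i • (X * Y) + v₂ i • (Y * X)
      + q₀ i • (1 + (-1 : K) • X) + q₁ i • (X * (Y * Y) + (-1 : K) • (Y * Y))
  let φ' : FreeAlgebra K ℕ →ₐ[K] FreeAlgebra K (Fin 2) := FreeAlgebra.lift K fun i =>
    p₀ i • X + u₂ i • (X * Y) + v₁ i • (Y * X) + q₀ i • (1 + (-1 : K) • X)
  let ψ : FreeAlgebra K (Fin 2) →ₐ[K] m11 K (Fin 2 → K) := FreeAlgebra.lift K
    ![⟨_, grassMat_mem 1 0 0 0 0 0 0 0⟩, ⟨_, grassMat_mem 0 0 1 0 0 1 0 0⟩]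
  let ψ' : FreeAlgebra K (Fin 2) →ₐ[K] m11 K (Fin 2 → K) := FreeAlgebra.lift K
    ![⟨_, grassMat_mem 1 0 0 0 0 0 0 0⟩, ⟨_, grassMat_mem 0 0 0 1 1 0 0 0⟩]
  have key : ∀ g : FreeAlgebra K ℕ, ∃ p₀ p₁ p₁' u₁ u₂ v₁ v₂ q₀ q₁ q₁' : K,
      (ψ (φ g) : Matrix (Fin 2) (Fin 2) (Efin K 2)) = grassMat p₀ p₁ u₁ 0 0 v₂ q₀ q₁ ∧
      (ψ' (φ' g) : Matrix (Fin 2) (Fin 2) (Efin K 2)) = grassMat p₀ p₁' 0 u₂ v₁ 0 q₀ q₁' ∧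
      (Φ g : Matrix (Fin 2) (Fin 2) (Efin K 2)) =
        grassMat p₀ (p₁ + p₁') u₁ u₂ v₁ v₂ q₀ (q₁ + q₁') := by
    intro g
    induction g using FreeAlgebra.induction with
    | grade0 r =>
      refine ⟨r, 0, 0, 0, 0, 0, 0, r, 0, 0, ?_⟩
      have : (algebraMap K (Matrix (Fin 2) (Fin 2) (Efin K 2)) r) = grassMat r 0 0 0 0 0 r 0 := by
        rw [Algebra.algebraMap_eq_smul_one, ← grassMat_one, smul_grassMat]
        simp
      simp only [AlgHom.commutes, Subalgebra.coe_algebraMap, this, add_zero, and_self]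
    | grade1 i =>
      refine ⟨p₀ i, p₁ i, 0, u₁ i, u₂ i, v₁ i, v₂ i, q₀ i, q₁ i, 0, ?_, ?_, ?_⟩
      · simp only [φ, ψ, X, Y, FreeAlgebra.lift_ι_apply, map_add, map_smul, map_mul, map_one,
          Matrix.cons_val_zero, Matrix.cons_val_one, Subalgebra.coe_add, Subalgebra.coe_mul,
          Subalgebra.coe_smul, Subalgebra.coe_one, ← grassMat_one, grassMat_mul, smul_grassMat,
          grassMat_add]
        congr 1 <;> ring
      · simp only [φ', ψ', X, Y, FreeAlgebra.lift_ι_apply, map_add, map_smul, map_mul, map_one,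
          Matrix.cons_val_zero, Matrix.cons_val_one, Subalgebra.coe_add, Subalgebra.coe_mul,
          Subalgebra.coe_smul, Subalgebra.coe_one, ← grassMat_one, grassMat_mul, smul_grassMat,
          grassMat_add]
        congr 1 <;> ring
      · rw [hΦ, add_zero, add_zero]
    | mul a b ha hb =>
      obtain ⟨a₁, a₂, a₃, a₄, a₅, a₆, a₇, a₈, a₉, a₀, h1, h2, h3⟩ := ha
      obtain ⟨b₁, b₂, b₃, b₄, b₅, b₆, b₇, b₈, b₉, b₀, h4, h5, h6⟩ := hb
      simp only [map_mul, Subalgebra.coe_mul, h1, h2, h3, h4, h5, h6, grassMat_mul]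
      refine ⟨a₁ * b₁, a₁ * b₂ + a₂ * b₁ + a₄ * b₇, a₁ * b₃ + a₃ * b₁ - a₅ * b₆,
        a₁ * b₄ + a₄ * b₈, a₁ * b₅ + a₅ * b₈, a₆ * b₁ + a₈ * b₆, a₇ * b₁ + a₈ * b₇,
        a₈ * b₈, a₈ * b₉ + a₉ * b₈ - a₇ * b₄, a₈ * b₀ + a₀ * b₈ + a₆ * b₅, ?_, ?_, ?_⟩ <;>
      congr 1 <;> ring
    | add a b ha hb =>
      obtain ⟨a₁, a₂, a₃, a₄, a₅, a₆, a₇, a₈, a₉, a₀, h1, h2, h3⟩ := ha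
      obtain ⟨b₁, b₂, b₃, b₄, b₅, b₆, b₇, b₈, b₉, b₀, h4, h5, h6⟩ := hb
      simp only [map_add, Subalgebra.coe_add, h1, h2, h3, h4, h5, h6, grassMat_add]
      refine ⟨a₁ + b₁, a₂ + b₂, a₃ + b₃, a₄ + b₄, a₅ + b₅, a₆ + b₆, a₇ + b₇, a₈ + b₈, a₉ + b₉,
        a₀ + b₀, ?_, ?_, ?_⟩ <;>
      congr 1 <;> ring
  obtain ⟨a₁, a₂, a₃, a₄, a₅, a₆, a₇, a₈, a₉, a₀, h1, h2, h3⟩ := key f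
  rw [h φ ψ] at h1
  rw [h φ' ψ'] at h2
  have hbody : ∀ c d : K, ExteriorAlgebra.algebraMapInv
      (c • 1 + d • (grassGen K 0 * grassGen K 1)) = c := by
    intro c d
    simp [grassGen, ExteriorAlgebra.algebraMapInv]
  have hp : a₁ = 0 := by
    have := congrArg (fun M => ExteriorAlgebra.algebraMapInv (M 0 0)) h1
    simpa [grassMat, hbody] using this.symm
  have hq : a₈ = 0 := by
    have := congrArg (fun M => ExteriorAlgebra.algebraMapInv (M 1 1)) h1
    simpa [grassMat, hbody] using this.symm
  apply Subtype.ext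
  rw [h3]
  have hsum := congrArg₂ (· + ·) h1 h2
  simp only [grassMat_add, hp, hq, add_zero, zero_add, ZeroMemClass.coe_zero] at hsum
  rw [hp, hq, ← hsum]
  rfl

end TwoGenerators

section GenericDiagonalization

open scoped TensorProduct

variable {K : Type} [Field K]

/-- A `2 × 2` matrix whose diagonal entries are even and differ by a unit, and whose off-diagonal
entries are odd, can be diagonalized. -/
theorem exists_m11_diagonalization [CharZero K] {V : Type} [AddCommGroup V] [Module K V]
    {x : Matrix (Fin 2) (Fin 2) (ExteriorAlgebra K V)} (hx : x ∈ m11 K V)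
    {b : ExteriorAlgebra K V} (hb : b ∈ evenPart K V) (hδ : b * (x 0 0 - x 1 1) = 1) :
    ∃ P ∈ m11 K V, ∃ Q ∈ m11 K V, ∃ d₁ ∈ evenPart K V, ∃ d₂ ∈ evenPart K V,
      P * Q = 1 ∧ x * P = P * !![d₁, 0; 0, d₂] := by
  obtain ⟨h00, h11, h01, h10⟩ := hx
  rw [Matrix.eta_fin_two x]
  generalize x 0 0 = x₁ at *
  generalize x 1 1 = x₂ at *
  generalize x 0 1 = ξ at *
  generalize x 1 0 = η at *
  have hα : b * ξ ∈ oddPart K V := even_mul_odd_mem K V hb h01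
  have hβ : b * η ∈ oddPart K V := even_mul_odd_mem K V hb h10
  have e1 : b * η * (ξ * (b * η)) = 0 := by
    rw [mul_anticomm_of_mem_oddPart h01 hβ, mul_neg, ← mul_assoc, mul_self_of_mem_oddPart hβ,
      zero_mul, neg_zero]
  have e2 : b * ξ * (η * (b * ξ)) = 0 := by
    rw [mul_anticomm_of_mem_oddPart h10 hα, mul_neg, ← mul_assoc, mul_self_of_mem_oddPart hα,
      zero_mul, neg_zero]
  have hδη : b * η * (x₁ - x₂) = η := by
    rw [mul_assoc, ← (commute_of_mem_evenPart (sub_mem h00 h11) η).eq, ← mul_assoc, hδ, one_mul]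
  have hδξ : b * ξ * (x₁ - x₂) = ξ := by
    rw [mul_assoc, ← (commute_of_mem_evenPart (sub_mem h00 h11) ξ).eq, ← mul_assoc, hδ, one_mul]
  have c1 := (commute_of_mem_evenPart h00 (b * ξ)).eq
  have c2 := (commute_of_mem_evenPart h11 (b * η)).eq
  have hd₁ : x₁ + ξ * (b * η) ∈ evenPart K V := add_mem h00 (oddPart_mul_mem_even K V h01 hβ)
  have hd₂ : x₂ - η * (b * ξ) ∈ evenPart K V := sub_mem h11 (oddPart_mul_mem_even K V h10 hα)
  generalize b * ξ = α at *
  generalize b * η = β at *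
  have hαβ : α * β ∈ evenPart K V := oddPart_mul_mem_even K V hα hβ
  have hβα : β * α = -(α * β) := mul_anticomm_of_mem_oddPart hβ hα
  have hsq : α * β * (α * β) = 0 := by
    rw [← mul_assoc, mul_assoc α, hβα, mul_neg, ← mul_assoc, mul_self_of_mem_oddPart hα]
    simp
  have h1 := evenPart_one_mem K V
  refine ⟨!![1, -α; β, 1], ⟨h1, h1, neg_mem hα, hβ⟩,
    !![1, α; -β, 1] * !![1 - α * β, 0; 0, 1 + α * β], mul_mem ⟨h1, h1, hα, neg_mem hβ⟩
      ⟨sub_mem h1 hαβ, add_mem h1 hαβ, zero_mem _, zero_mem _⟩,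
    x₁ + ξ * β, hd₁, x₂ - η * α, hd₂, ?_, ?_⟩
  · rw [← mul_assoc, Matrix.mul_fin_two, Matrix.mul_fin_two, Matrix.one_fin_two]
    congr 1
    simp only [mul_one, one_mul, mul_neg, neg_mul, add_neg_cancel, hβα, mul_zero,
      zero_mul, add_zero, zero_add, mul_sub, mul_add, add_mul, neg_neg, hsq]
    simp
  · rw [Matrix.mul_fin_two, Matrix.mul_fin_two]
    have g1 : η + x₂ * β = β * (x₁ + ξ * β) := by
      rw [mul_add, e1, add_zero, c2, ← hδη]
      noncomm_ring
    have g2 : x₁ * -α + ξ = -α * (x₂ - η * α) := by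
      rw [mul_sub, neg_mul α (η * α), e2, neg_zero, sub_zero, mul_neg, c1, ← hδξ]
      noncomm_ring
    congr 1
    simp only [mul_one, one_mul, mul_zero, add_zero, zero_add, g1, g2]
    congr 3
    rw [mul_neg]
    abel_nf

/-- An identity of `M_{1,1}^{(2)}` vanishes on the algebra generated by a diagonal matrix and an
arbitrary matrix of `M_{1,1}(Λ V)`: this algebra only involves two odd elements. -/
theorem eq_zero_of_isPI_of_diagonal [CharZero K] {V : Type} [AddCommGroup V] [Module K V]
    {f : FreeAlgebra K ℕ} (hf : IsPI K (m11 K (Fin 2 → K)) f)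
    {d₁ d₂ : ExteriorAlgebra K V} (hd₁ : d₁ ∈ evenPart K V) (hd₂ : d₂ ∈ evenPart K V)
    {y : Matrix (Fin 2) (Fin 2) (ExteriorAlgebra K V)} (hy : y ∈ m11 K V)
    (φ : FreeAlgebra K ℕ →ₐ[K] FreeAlgebra K (Fin 2)) :
    FreeAlgebra.lift K ![!![d₁, 0; 0, d₂], y] (φ f) = 0 := by
  obtain ⟨h00, h11, h01, h10⟩ := hy
  let ℓ : (Fin 2 → K) →ₗ[K] ExteriorAlgebra K V := Fintype.linearCombination K ![y 0 1, y 1 0]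
  have hℓ : ∀ v, ℓ v ∈ oddPart K V := fun v => by
    rw [Fintype.linearCombination_apply, Fin.sum_univ_two]
    exact add_mem (Submodule.smul_mem _ _ h01) (Submodule.smul_mem _ _ h10)
  let F : Efin K 2 →ₐ[K] ExteriorAlgebra K V :=
    ExteriorAlgebra.lift K ⟨ℓ, fun v => mul_self_of_mem_oddPart (hℓ v)⟩
  have hF : ∀ v, F (ExteriorAlgebra.ι K v) ∈ oddPart K V := fun v => by
    rw [ExteriorAlgebra.lift_ι_apply]
    exact hℓ v
  let Z := Subalgebra.center K (Matrix (Fin 2) (Fin 2) (ExteriorAlgebra K V))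
  have hscalar : ∀ a ∈ evenPart K V,
      (!![a, 0; 0, a] : Matrix (Fin 2) (Fin 2) (ExteriorAlgebra K V)) ∈ Z := fun a ha => by
    rw [Subalgebra.mem_center_iff]
    intro M
    have hc := fun c => (commute_of_mem_evenPart ha c).eq
    rw [Matrix.eta_fin_two M, Matrix.mul_fin_two, Matrix.mul_fin_two]
    simp [hc]
  let H : m11 K (Fin 2 → K) ⊗[K] Z →ₐ[K] Matrix (Fin 2) (Fin 2) (ExteriorAlgebra K V) :=
    Algebra.TensorProduct.lift ((m11 K V).val.comp (m11Map F hF)) Z.val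
      fun a z => (Subalgebra.mem_center_iff.mp z.2 _)
  let u : m11 K (Fin 2 → K) := ⟨_, grassMat_mem 1 0 0 0 0 0 0 0⟩
  let u' : m11 K (Fin 2 → K) := ⟨_, grassMat_mem 0 0 0 0 0 0 1 0⟩
  let o : m11 K (Fin 2 → K) := ⟨_, grassMat_mem 0 0 1 0 0 1 0 0⟩
  have hFg : F (grassGen K 0) = y 0 1 ∧ F (grassGen K 1) = y 1 0 := by
    constructor <;>
    simp [F, grassGen, ℓ, Fintype.linearCombination_apply]
  have hH : ∀ (M : m11 K (Fin 2 → K)) (z : Z), H (M ⊗ₜ z) = M.1.map F * z.1 := fun M z => rfl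
  have hu : u.1.map F = !![1, 0; 0, 0] := by
    ext i j
    fin_cases i <;> fin_cases j <;> simp [u, grassMat]
  have hu' : u'.1.map F = !![0, 0; 0, 1] := by
    ext i j
    fin_cases i <;> fin_cases j <;> simp [u', grassMat]
  have ho : o.1.map F = !![0, y 0 1; y 1 0, 0] := by
    ext i j
    fin_cases i <;> fin_cases j <;> simp [o, grassMat, hFg]
  have hX : H (u ⊗ₜ ⟨_, hscalar _ hd₁⟩ + u' ⊗ₜ ⟨_, hscalar _ hd₂⟩) = !![d₁, 0; 0, d₂] := by
    rw [map_add, hH, hH, hu, hu', Matrix.mul_fin_two, Matrix.mul_fin_two]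
    simp
  have hY : H (u ⊗ₜ ⟨_, hscalar _ h00⟩ + u' ⊗ₜ ⟨_, hscalar _ h11⟩ + o ⊗ₜ 1) = y := by
    rw [map_add, map_add, hH, hH, hH, hu, hu', ho, Subalgebra.coe_one, mul_one,
      Matrix.mul_fin_two, Matrix.mul_fin_two]
    conv_rhs => rw [Matrix.eta_fin_two y]
    simp
  have hcomp : FreeAlgebra.lift K ![!![d₁, 0; 0, d₂], y] = H.comp (FreeAlgebra.lift K
      ![u ⊗ₜ ⟨_, hscalar _ hd₁⟩ + u' ⊗ₜ ⟨_, hscalar _ hd₂⟩,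
        u ⊗ₜ ⟨_, hscalar _ h00⟩ + u' ⊗ₜ ⟨_, hscalar _ h11⟩ + o ⊗ₜ 1]) := by
    ext i : 2
    fin_cases i
    · simpa using hX.symm
    · simpa using hY.symm
  rw [hcomp, AlgHom.comp_apply, ← AlgHom.comp_apply _ φ, hf.tensorProduct, map_zero]

/-- An identity of `M_{1,1}^{(2)}` vanishes on all 2-generated subalgebras of `M_{1,1}(Λ V)`. -/
theorem eq_zero_of_isPI_m11_two [CharZero K] {V : Type} [AddCommGroup V] [Module K V]
    {f : FreeAlgebra K ℕ} (hf : IsPI K (m11 K (Fin 2 → K)) f)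
    (φ : FreeAlgebra K ℕ →ₐ[K] FreeAlgebra K (Fin 2))
    (ψ : FreeAlgebra K (Fin 2) →ₐ[K] m11 K V) : ψ (φ f) = 0 := by
  let x : Fin 2 → m11 K V := fun i => ψ (FreeAlgebra.ι K i)
  have hψ : ψ = FreeAlgebra.lift K x := by
    ext i
    simp [x]
  rw [hψ]
  obtain ⟨t₀, ht₀⟩ := exists_evenPart_mul_eq_one (sub_mem (x 0).2.1 (x 0).2.2.1)
  let d : m11 K V := ⟨!![1, 0; 0, 0], evenPart_one_mem K V, zero_mem _, zero_mem _, zero_mem _⟩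
  refine lift_eq_zero_of_perturbation x ![d, 0] t₀ _ fun t ht => ?_
  obtain ⟨b, hb, hbδ⟩ := ht₀ t ht
  have hx₀ : ((x + t • ![d, 0]) 0).1 = (x 0).1 + t • !![1, 0; 0, 0] := rfl
  have hδ : b * (((x + t • ![d, 0]) 0).1 0 0 - ((x + t • ![d, 0]) 0).1 1 1) = 1 := by
    rw [← hbδ, hx₀]
    congr 1
    simp [Algebra.algebraMap_eq_smul_one]
    abel
  clear hx₀
  generalize x + t • ![d, 0] = x' at *
  obtain ⟨P, hP, Q, hQ, d₁, hd₁, d₂, hd₂, hPQ, hxP⟩ := exists_m11_diagonalization (x' 0).2 hb hδ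
  have h0 := eq_zero_of_isPI_of_diagonal hf hd₁ hd₂
    (mul_mem (mul_mem hQ (x' 1).2) hP) φ
  set Ψ := FreeAlgebra.lift K ![!![d₁, 0; 0, d₂], Q * (x' 1).1 * P] with hΨ
  have hconj : ∀ g, (FreeAlgebra.lift K x' g : m11 K V).1 * P = P * Ψ g := by
    intro g
    induction g using FreeAlgebra.induction with
    | grade0 r =>
      rw [AlgHom.commutes, AlgHom.commutes]
      exact Algebra.commutes r P
    | grade1 i =>
      rw [FreeAlgebra.lift_ι_apply, hΨ, FreeAlgebra.lift_ι_apply]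
      fin_cases i
      · exact hxP
      · change (x' 1).1 * P = P * (Q * (x' 1).1 * P)
        rw [← mul_assoc, ← mul_assoc, hPQ, one_mul]
    | mul a b ha hb =>
      rw [map_mul, map_mul, Subalgebra.coe_mul, mul_assoc, hb, ← mul_assoc, ha, mul_assoc]
    | add a b ha hb =>
      rw [map_add, map_add, Subalgebra.coe_add, add_mul, ha, hb, mul_add]
  apply Subtype.ext
  have h1 := congrArg (· * Q) (hconj (φ f))
  simp only [h0, mul_zero, zero_mul, mul_assoc, hPQ, mul_one] at h1
  exact h1

end GenericDiagonalization

/-- `M_{1,1}^{(2)}` is a subalgebra of `M_{1,1}(E)`. -/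
theorem exists_m11_two_leftInverse (K : Type) [Field K] :
    ∃ (I : m11 K (Fin 2 → K) →ₐ[K] m11 K (ℕ →₀ K)) (J : m11 K (ℕ →₀ K) →ₐ[K] m11 K (Fin 2 → K)),
      ∀ M, J (I M) = M := by
  let i : (Fin 2 → K) →ₗ[K] (ℕ →₀ K) :=
    Fintype.linearCombination K fun k : Fin 2 => Finsupp.single (k : ℕ) (1 : K)
  let j : (ℕ →₀ K) →ₗ[K] (Fin 2 → K) := LinearMap.pi fun k => Finsupp.lapply (k : ℕ)
  have hji : j ∘ₗ i = LinearMap.id := by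
    ext k l
    fin_cases k <;> fin_cases l <;> simp [i, j]
  have hmap : ∀ {V W : Type} [AddCommGroup V] [Module K V] [AddCommGroup W] [Module K W]
      (g : V →ₗ[K] W) (v : V),
      ExteriorAlgebra.map g (ExteriorAlgebra.ι K v) ∈ oddPart K W := fun g v => by
    rw [ExteriorAlgebra.map_apply_ι]
    exact ι_mem_oddPart _
  refine ⟨m11Map (ExteriorAlgebra.map i) (hmap i), m11Map (ExteriorAlgebra.map j) (hmap j),
    fun M => Subtype.ext ?_⟩
  rw [m11Map_apply, m11Map_apply, Matrix.map_map, ← AlgHom.coe_comp,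
    ExteriorAlgebra.map_comp_map, hji, ExteriorAlgebra.map_id]
  simp

/-- The relatively free algebra `F₂(M_{1,1}(E))` and the finite-dimensional
algebra `M_{1,1}⁽²⁾` satisfy the same polynomial identities. -/
theorem tideal_relfree_m11_eq_tideal_m11_fin (K : Type) [Field K] [CharZero K] :
    TId K (RelFree K (↥(m11 K (ℕ →₀ K))) 2) = TId K (↥(m11 K (Fin 2 → K))) := by
  ext f
  rw [mem_TId_relFree_iff]
  refine ⟨fun h => ?_, fun h φ ψ => eq_zero_of_isPI_m11_two h φ ψ⟩
  obtain ⟨I, J, hJI⟩ := exists_m11_two_leftInverse K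
  refine isPI_m11_two_of_two_generated fun φ ψ => ?_
  rw [← hJI (ψ (φ f)), ← AlgHom.comp_apply I ψ, h, map_zero]
end

section
/- For every m ≥ 1, the relatively free algebra F_m(E) of rank m of the variety generated by the Grassmann algebra E and the finite-dimensional Grassmann algebra E^{(m)} satisfy the same polynomial identities: T(F_m(E)) = T(E^{(m)}). -/
/-- Identities pass to algebras that embed. -/
theorem IsPI.of_injective {K : Type} [Field K] {X R S : Type} [Ring R] [Algebra K R] [Ring S]
    [Algebra K S] {f : FreeAlgebra K X} (hf : IsPI K S f) (g : R →ₐ[K] S)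
    (hg : Function.Injective g) : IsPI K R f := fun φ =>
  hg (by rw [map_zero]; exact hf (g.comp φ))

/-- Identities pass to quotients. -/
theorem IsPI.of_surjective {K : Type} [Field K] {X R S : Type} [Ring R] [Algebra K R] [Ring S]
    [Algebra K S] {f : FreeAlgebra K X} (hf : IsPI K R f) (g : R →ₐ[K] S)
    (hg : Function.Surjective g) : IsPI K S f := fun φ => by
  choose h hh using fun i => hg (φ (FreeAlgebra.ι K i))
  have : φ = g.comp (FreeAlgebra.lift K h) := by
    ext i
    simp [hh]
  rw [this, AlgHom.comp_apply, hf, map_zero]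

/-- Over an infinite field, extending scalars to a polynomial ring preserves identities. -/
theorem IsPI.mvPolynomial_tensor {K : Type} [Field K] [Infinite K] {X σ R : Type} [Ring R]
    [Algebra K R] {f : FreeAlgebra K X} (hf : IsPI K R f) :
    IsPI K (TensorProduct K (MvPolynomial σ K) R) f := fun φ => by
  let b := Module.Basis.ofVectorSpace K R
  let B := Algebra.TensorProduct.basis (MvPolynomial σ K) b
  have hcomm : ∀ (p : σ → K) (x : MvPolynomial σ K) (y : R),
      Commute ((Algebra.ofId K R).comp (MvPolynomial.aeval p) x) (AlgHom.id K R y) :=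
    fun p x y => Algebra.commutes _ _
  have key : ∀ (p : σ → K) (u : TensorProduct K (MvPolynomial σ K) R) i,
      MvPolynomial.eval p (B.repr u i) =
        b.repr (Algebra.TensorProduct.lift ((Algebra.ofId K R).comp (MvPolynomial.aeval p))
          (AlgHom.id K R) (hcomm p) u) i := by
    intro p u i
    induction u with
    | zero => simp
    | add x y hx hy => simp [hx, hy]
    | tmul q r =>
      simp [B, Algebra.TensorProduct.basis_repr_tmul, Algebra.ofId_apply,
        ← Algebra.smul_def, MvPolynomial.aeval_eq_eval]
  refine B.ext_elem fun i => MvPolynomial.funext fun p => ?_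
  rw [key, ← AlgHom.comp_apply, hf]
  simp

section Parity

variable {K V : Type} [Field K] [AddCommGroup V] [Module K V]

open ExteriorAlgebra

theorem ExteriorAlgebra.ι_mul_ι_comm (v w : V) : ι K v * ι K w = -(ι K w * ι K v) :=
  eq_neg_of_add_eq_zero_left (ι_add_mul_swap v w)

theorem evenPart_le_center {a : ExteriorAlgebra K V} (ha : a ∈ evenPart K V) :
    a ∈ Subalgebra.center K (ExteriorAlgebra K V) := by
  induction a, ha using CliffordAlgebra.even_induction (0 : QuadraticForm K V) with
  | algebraMap r => exact Subalgebra.algebraMap_mem _ r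
  | add x y _ _ hx hy => exact Subalgebra.add_mem _ hx hy
  | ι_mul_ι_mul v w x _ hx =>
    refine Subalgebra.mul_mem _ (Subalgebra.mem_center_iff.2 fun c => ?_) hx
    change c * (ι K v * ι K w) = ι K v * ι K w * c
    induction c using ExteriorAlgebra.induction with
    | algebraMap r => exact Algebra.commutes _ _
    | ι u =>
      rw [← mul_assoc, ι_mul_ι_comm u v, neg_mul, mul_assoc, ι_mul_ι_comm u w, mul_neg, neg_neg,
        mul_assoc]
    | mul x y hx hy => rw [mul_assoc, hy, ← mul_assoc, hx, mul_assoc]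
    | add x y hx hy => rw [add_mul, hx, hy, mul_add]

theorem oddPart_mul_ι {b : ExteriorAlgebra K V} (hb : b ∈ oddPart K V) (v : V) :
    b * ι K v = -(ι K v * b) := by
  induction b, hb using CliffordAlgebra.odd_induction (0 : QuadraticForm K V) with
  | ι w => exact ι_mul_ι_comm w v
  | add x y _ _ hx hy => rw [add_mul, hx, hy, mul_add, neg_add]
  | ι_mul_ι_mul u w x _ hx =>
    change ι K u * ι K w * x * ι K v = -(ι K v * (ι K u * ι K w * x))
    rw [mul_assoc, hx, mul_neg, ← mul_assoc, mul_assoc (ι K u), ι_mul_ι_comm w v, mul_neg,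
      ← mul_assoc, ι_mul_ι_comm u v]
    simp only [neg_mul, neg_neg, mul_assoc]

theorem oddPart_mul_comm {b c : ExteriorAlgebra K V} (hb : b ∈ oddPart K V)
    (hc : c ∈ oddPart K V) : b * c = -(c * b) := by
  induction c, hc using CliffordAlgebra.odd_induction (0 : QuadraticForm K V) with
  | ι w => exact oddPart_mul_ι hb w
  | add x y _ _ hx hy => rw [mul_add, hx, hy, add_mul, neg_add]
  | ι_mul_ι_mul u w x _ hx =>
    change b * (ι K u * ι K w * x) = -(ι K u * ι K w * x * b)
    rw [← mul_assoc, ← mul_assoc, oddPart_mul_ι hb, neg_mul, mul_assoc (ι K u),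
      oddPart_mul_ι hb, mul_neg, neg_mul, neg_mul, neg_neg, ← mul_assoc, mul_assoc _ b, hx, mul_neg,
      mul_assoc _ x]

theorem oddPart_sq [CharZero K] {b : ExteriorAlgebra K V} (hb : b ∈ oddPart K V) :
    b * b = 0 := by
  have : IsAddTorsionFree (ExteriorAlgebra K V) := .of_isTorsionFree K _
  exact self_eq_neg.1 (oddPart_mul_comm hb hb)

theorem exists_even_add_odd (x : ExteriorAlgebra K V) :
    ∃ a ∈ evenPart K V, ∃ b ∈ oddPart K V, a + b = x := by
  have h := (CliffordAlgebra.evenOdd_isCompl (Q := (0 : QuadraticForm K V))).sup_eq_top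
  exact Submodule.mem_sup.1 (h ▸ Submodule.mem_top : x ∈ _)

end Parity

/-- The generic model of `F_m(E)`: every homomorphism from `K⟨x₁, …, x_m⟩` to a Grassmann algebra
factors through `xᵢ ↦ yᵢ ⊗ 1 + 1 ⊗ eᵢ` in `K[y₁, …, y_m] ⊗ E⁽ᵐ⁾`. -/
theorem exists_factor_generic {K V : Type} [Field K] [CharZero K] [AddCommGroup V] [Module K V]
    {m : ℕ} (φ : FreeAlgebra K (Fin m) →ₐ[K] ExteriorAlgebra K V) :
    ∃ (g : FreeAlgebra K (Fin m) →ₐ[K] TensorProduct K (MvPolynomial (Fin m) K) (Efin K m))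
      (π : TensorProduct K (MvPolynomial (Fin m) K) (Efin K m) →ₐ[K] ExteriorAlgebra K V),
      φ = π.comp g := by
  choose a ha b hb hab using fun i => exists_even_add_odd (φ (FreeAlgebra.ι K i))
  let ev : MvPolynomial (Fin m) K →ₐ[K] ExteriorAlgebra K V :=
    (Subalgebra.center K _).val.comp
      (MvPolynomial.aeval fun i =>
        (⟨a i, evenPart_le_center (ha i)⟩ : Subalgebra.center K (ExteriorAlgebra K V)))
  let od : Efin K m →ₐ[K] ExteriorAlgebra K V :=
    ExteriorAlgebra.lift K ⟨Fintype.linearCombination K b, fun v => oddPart_sq <|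
      show ∑ i, v i • b i ∈ _ from Submodule.sum_mem _ fun i _ => Submodule.smul_mem _ _ (hb i)⟩
  have hcomm : ∀ x y, Commute (ev x) (od y) := fun x y =>
    (Subalgebra.mem_center_iff.1 (MvPolynomial.aeval _ x : Subalgebra.center K _).2 _).symm
  refine ⟨FreeAlgebra.lift K fun i =>
      MvPolynomial.X i ⊗ₜ 1 + 1 ⊗ₜ ExteriorAlgebra.ι K (Pi.single i 1),
    Algebra.TensorProduct.lift ev od hcomm, ?_⟩
  ext i
  simp [ev, od, ← hab, Fintype.linearCombination_apply_single]

/-- `E⁽ᵐ⁾` satisfies the identities of `E`. -/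
theorem IsPI.efin_of_einf {K : Type} [Field K] {X : Type} {f : FreeAlgebra K X}
    (hf : IsPI K (Einf K) f) (m : ℕ) : IsPI K (Efin K m) f := by
  let i : (Fin m → K) →ₗ[K] (ℕ →₀ K) :=
    Finsupp.lmapDomain K K Fin.val ∘ₗ (Finsupp.linearEquivFunOnFinite K K (Fin m)).symm.toLinearMap
  have hi : Function.Injective i :=
    (Finsupp.mapDomain_injective Fin.val_injective).comp (LinearEquiv.injective _)
  refine hf.of_injective (ExteriorAlgebra.map i) ?_
  exact ExteriorAlgebra.map_injective_field (LinearMap.ker_eq_bot.2 hi)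

/-- `E⁽ᵐ⁾` is a quotient of `F_m(E)`. -/
theorem exists_surjective_relFree_efin (K : Type) [Field K] (m : ℕ) :
    ∃ g : RelFree K (Einf K) m →ₐ[K] Efin K m, Function.Surjective g := by
  let e : FreeAlgebra K (Fin m) →ₐ[K] Efin K m :=
    FreeAlgebra.lift K fun i => ExteriorAlgebra.ι K (Pi.single i 1)
  have he : Function.Surjective e := by
    rw [← AlgHom.range_eq_top, eq_top_iff, ← CliffordAlgebra.adjoin_range_ι, Algebra.adjoin_le_iff]
    rintro _ ⟨v, rfl⟩
    rw [pi_eq_sum_univ' v, map_sum]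
    refine Subalgebra.sum_mem _ fun i _ => ?_
    rw [map_smul]
    exact Subalgebra.smul_mem _ (e.mem_range.2 ⟨FreeAlgebra.ι K i, by simp [e]⟩) _
  refine ⟨RingQuot.liftAlgHom K ⟨e, fun x y h => ?_⟩, fun z => ?_⟩
  · exact sub_eq_zero.1 (by rw [← map_sub]; exact h.efin_of_einf m e)
  · obtain ⟨x, rfl⟩ := he z
    exact ⟨RingQuot.mkAlgHom K _ x, by simp⟩

/-- For every `m ≥ 1`, the relatively free algebra `F_m(E)` and the
finite-dimensional Grassmann algebra `E⁽ᵐ⁾` satisfy the same polynomial identities. -/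
theorem tideal_relfree_grassmann_eq_tideal_grassmann_fin (K : Type) [Field K] [CharZero K]
    (m : ℕ) (hm : 1 ≤ m) :
    TId K (RelFree K (Einf K) m) = TId K (Efin K m) := by
  ext f
  constructor
  · intro hf
    obtain ⟨g, hg⟩ := exists_surjective_relFree_efin K m
    exact IsPI.of_surjective hf g hg
  · intro hf ψ
    choose h hh using fun i => RingQuot.mkAlgHom_surjective K
      (fun f g : FreeAlgebra K (Fin m) => IsPI K (Einf K) (f - g)) (ψ (FreeAlgebra.ι K i))
    have hψ : ψ = (RingQuot.mkAlgHom K _).comp (FreeAlgebra.lift K h) := by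
      ext i
      simp [hh]
    have hPI : IsPI K (Einf K) (FreeAlgebra.lift K h f - 0) := fun φ => by
      obtain ⟨g, π, rfl⟩ := exists_factor_generic φ
      have h0 : g (FreeAlgebra.lift K h f) = 0 :=
        IsPI.mvPolynomial_tensor hf (g.comp (FreeAlgebra.lift K h))
      rw [sub_zero, AlgHom.comp_apply, h0, map_zero]
    rw [hψ, AlgHom.comp_apply, RingQuot.mkAlgHom_rel K hPI, map_zero]
end

section
/- The T-ideal of polynomial identities of the algebra A′ is generated as a T-ideal by the polynomial [x₁,x₂,x₃][x₄,x₅]; that is, T(A′) = ⟨[x₁,x₂,x₃][x₄,x₅]⟩^T. -/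
open scoped TensorProduct

section PolynomialCoefficients

variable {K : Type} [Field K] {B C : Type} [Ring B] [Algebra K B] [Ring C] [Algebra K C]

/-- Evaluation of a polynomial with coefficients in `B`: the coefficients are sent to `C` by `φ`
and the variables to the scalars `β`. -/
noncomputable def evalPolyTensor (φ : B →ₐ[K] C) (β : ℕ → K) :
    B ⊗[K] MvPolynomial ℕ K →ₐ[K] C :=
  Algebra.TensorProduct.lift φ ((Algebra.ofId K C).comp (MvPolynomial.aeval β))
    fun _ _ => by
      rw [AlgHom.comp_apply, Algebra.ofId_apply]
      exact Algebra.commute_algebraMap_right _ _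

theorem evalPolyTensor_tmul (φ : B →ₐ[K] C) (β : ℕ → K) (b : B) (p : MvPolynomial ℕ K) :
    evalPolyTensor φ β (b ⊗ₜ p) = MvPolynomial.eval β p • φ b := by
  rw [evalPolyTensor, Algebra.TensorProduct.lift_tmul, Algebra.smul_def, Algebra.commutes]
  simp [Algebra.ofId_apply, MvPolynomial.aeval_eq_eval]

theorem exists_eq_sum_tmul_monomial (z : B ⊗[K] MvPolynomial ℕ K) :
    ∃ b : (ℕ →₀ ℕ) →₀ B, z = b.sum fun m a => a ⊗ₜ MvPolynomial.monomial m 1 := by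
  classical
  refine ⟨TensorProduct.equivFinsuppOfBasisRight (MvPolynomial.basisMonomials ℕ K) z, ?_⟩
  conv_lhs => rw [← (TensorProduct.equivFinsuppOfBasisRight
    (MvPolynomial.basisMonomials ℕ K)).symm_apply_apply z]
  rw [TensorProduct.equivFinsuppOfBasisRight_symm_apply]
  simp

theorem map_coeff_eq_zero_of_evalPolyTensor [Infinite K] (φ : B →ₐ[K] C) {b : (ℕ →₀ ℕ) →₀ B}
    (h : ∀ β, evalPolyTensor φ β (b.sum fun m a => a ⊗ₜ MvPolynomial.monomial m 1) = 0)
    (m : ℕ →₀ ℕ) : φ (b m) = 0 := by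
  classical
  refine (Module.forall_dual_apply_eq_zero_iff K _).1 fun ℓ => ?_
  have hp : (b.sum fun m a => MvPolynomial.monomial m (ℓ (φ a))) = 0 := by
    refine MvPolynomial.funext fun β => ?_
    have := congrArg ℓ (h β)
    simp only [Finsupp.sum, map_sum, evalPolyTensor_tmul, map_smul, map_zero, smul_eq_mul,
      MvPolynomial.eval_monomial, one_mul] at this ⊢
    rw [← this]
    exact Finset.sum_congr rfl fun _ _ => mul_comm _ _
  have := congrArg (MvPolynomial.coeff m) hp
  simp only [Finsupp.sum, MvPolynomial.coeff_sum, MvPolynomial.coeff_monomial,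
    MvPolynomial.coeff_zero, Finset.sum_ite_eq', Finsupp.mem_support_iff] at this
  by_cases hm : b m = 0
  · simp [hm]
  · simpa [hm] using this

end PolynomialCoefficients

section Brackets

variable {Q : Type} [Ring Q]

theorem br_mul_right (a b c : Q) : br a (b * c) = b * br a c + br a b * c := by
  simp only [br]; noncomm_ring

theorem commute_br (h : ∀ a b c : Q, br (br a b) c = 0) (a b c : Q) : br a b * c = c * br a b :=
  sub_eq_zero.1 (h a b c)

theorem br_mul_br_eq_zero (K : Type) [Field K] [CharZero K] [Algebra K Q]
    (h : ∀ a b c : Q, br (br a b) c = 0) (a b c : Q) :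
    br a b * br b c = 0 := by
  have h1 := h a (b * b) c
  have e : br (br a (b * b)) c
      = br a b * br b c + br b c * br a b + (b * br (br a b) c + br (br a b) c * b) := by
    simp only [br]; noncomm_ring
  rw [e, h a b c, commute_br h b c] at h1
  have h2 : (2 : K) • (br a b * br b c) = 0 := by
    rw [two_smul]; simpa using h1
  exact (smul_eq_zero.1 h2).resolve_left two_ne_zero

variable {K : Type} [Field K] [CharZero K] [Algebra K Q]

/-- In an algebra with central commutators, a linear map `L` from a vector space `V` induces a
linear map on the exterior algebra that kills the odd part and sends a product `v₁ ⋯ v₂ₖ` of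
vectors to the product of the half commutators of the `L v₂ᵢ₋₁` and `L v₂ᵢ`. -/
theorem exists_exteriorAlgebra_halfCommutator {V : Type} [AddCommGroup V] [Module K V]
    (h : ∀ a b c : Q, br (br a b) c = 0) (L : V →ₗ[K] Q) :
    ∃ c : ExteriorAlgebra K V →ₗ[K] Q, c 1 = 1 ∧ (∀ v, c (ExteriorAlgebra.ι K v) = 0) ∧
      ∀ u v w, c (ExteriorAlgebra.ι K u * (ExteriorAlgebra.ι K v * w)) =
        (1 / 2 : K) • br (L u) (L v) * c w := by
  let T : CliffordAlgebra.EvenHom (0 : QuadraticForm K V) Q :=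
    { bilin := LinearMap.mk₂ K (fun u v => (1 / 2 : K) • br (L u) (L v))
        (fun _ _ _ => by simp only [br, map_add, ← smul_add]; congr 1; noncomm_ring)
        (fun _ _ _ => by
          simp only [br, map_smul, smul_mul_assoc, mul_smul_comm, ← smul_sub]
          rw [smul_comm])
        (fun _ _ _ => by simp only [br, map_add, ← smul_add]; congr 1; noncomm_ring)
        (fun _ _ _ => by
          simp only [br, map_smul, smul_mul_assoc, mul_smul_comm, ← smul_sub]
          rw [smul_comm])
      contract := fun _ => by simp [br]
      contract_mid := fun _ _ _ => by
        simp [br_mul_br_eq_zero K h] }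
  let E := CliffordAlgebra.even (0 : QuadraticForm K V)
  let P : ExteriorAlgebra K V →ₗ[K] E :=
    LinearMap.codRestrict (Subalgebra.toSubmodule E)
      (GradedAlgebra.proj (CliffordAlgebra.evenOdd (0 : QuadraticForm K V)) 0)
      (fun w => SetLike.coe_mem _)
  have hP : ∀ w, (P w : ExteriorAlgebra K V) =
    DirectSum.decompose (CliffordAlgebra.evenOdd (0 : QuadraticForm K V)) w 0 := fun _ => rfl
  refine ⟨(CliffordAlgebra.even.lift _ T).toLinearMap ∘ₗ P, ?_, ?_, ?_⟩
  · have : P 1 = 1 := Subtype.ext (by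
      rw [hP, DirectSum.decompose_of_mem_same _ (SetLike.one_mem_graded _)]; rfl)
    simp [this]
  · intro v
    have : P (ExteriorAlgebra.ι K v) = 0 := Subtype.ext (by
      rw [hP, DirectSum.decompose_of_mem_ne _
        (CliffordAlgebra.ι_mem_evenOdd_one (0 : QuadraticForm K V) v) (by decide)]; rfl)
    simp [this]
  · intro u v w
    have : P (ExteriorAlgebra.ι K u * (ExteriorAlgebra.ι K v * w)) =
        (CliffordAlgebra.even.ι _).bilin u v * P w := Subtype.ext (by
      rw [hP, ← mul_assoc, DirectSum.coe_decompose_mul_of_left_mem_zero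
        (CliffordAlgebra.evenOdd (0 : QuadraticForm K V))
        (CliffordAlgebra.ι_mul_ι_mem_evenOdd_zero (0 : QuadraticForm K V) u v)]; rfl)
    simp only [LinearMap.comp_apply, this, AlgHom.toLinearMap_apply, map_mul,
      CliffordAlgebra.even.lift_ι]
    rfl

end Brackets

open scoped IsMulCommutative in
/-- Pairwise commuting elements of an algebra are the images of the variables under an algebra
homomorphism from a polynomial ring. -/
theorem exists_mvPolynomial_algHom {K : Type} [Field K] {R : Type} [Ring R] [Algebra K R]
    (t : ℕ → R) (ht : ∀ i j, t i * t j = t j * t i) :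
    ∃ τ : MvPolynomial ℕ K →ₐ[K] R, ∀ i, τ (MvPolynomial.X i) = t i := by
  have hc : ∀ a ∈ Set.range t, ∀ b ∈ Set.range t, a * b = b * a := by
    rintro _ ⟨i, rfl⟩ _ ⟨j, rfl⟩
    exact ht i j
  have := Algebra.isMulCommutative_adjoin K hc
  refine ⟨(Algebra.adjoin K (Set.range t)).val.comp (MvPolynomial.aeval
    fun i => (⟨t i, Algebra.subset_adjoin ⟨i, rfl⟩⟩ : Algebra.adjoin K (Set.range t))), ?_⟩
  intro i
  simp

section Grassmann

variable (K : Type) [Field K]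

/-- The generic substitution `xᵢ ↦ tᵢ + eᵢ` with `tᵢ` polynomial variables and `eᵢ` the
generators of the Grassmann algebra. -/
noncomputable def genericGrassmann :
    FreeAlgebra K ℕ →ₐ[K] Einf K ⊗[K] MvPolynomial ℕ K :=
  FreeAlgebra.lift K fun i =>
    ExteriorAlgebra.ι K (Finsupp.single i 1) ⊗ₜ 1 + 1 ⊗ₜ MvPolynomial.X i

theorem genericGrassmann_eq_zero [Infinite K] {f : FreeAlgebra K ℕ} (hf : IsPI K (Einf K) f) :
    genericGrassmann K f = 0 := by
  obtain ⟨b, hb⟩ := exists_eq_sum_tmul_monomial (genericGrassmann K f)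
  have h0 : b = 0 := Finsupp.ext fun m =>
    map_coeff_eq_zero_of_evalPolyTensor (AlgHom.id K _)
      (fun β => by rw [← hb]; exact hf ((evalPolyTensor (AlgHom.id K _) β).comp _)) m
  rw [hb, h0, Finsupp.sum_zero_index]

variable {K}

theorem algHom_eq_zero_of_isPI_grassmann [CharZero K] {Q : Type} [Ring Q] [Algebra K Q]
    (h : ∀ a b c : Q, br (br a b) c = 0) (π : FreeAlgebra K ℕ →ₐ[K] Q)
    {f : FreeAlgebra K ℕ} (hf : IsPI K (Einf K) f) : π f = 0 := by
  let x : ℕ → Q := fun i => π (FreeAlgebra.ι K i)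
  let L : (ℕ →₀ K) →ₗ[K] Q := Finsupp.linearCombination K x
  obtain ⟨c, c_one, c_ι, c_mul⟩ := exists_exteriorAlgebra_halfCommutator h L
  let t : ℕ → Module.End K Q := fun i =>
    (1 / 2 : K) • (LinearMap.mulLeft K (x i) + LinearMap.mulRight K (x i))
  have t_apply : ∀ i a, t i a = (1 / 2 : K) • (x i * a + a * x i) := fun _ _ => rfl
  have t_comm : ∀ i j, t i * t j = t j * t i := by
    intro i j
    ext a
    simp only [Module.End.mul_apply, t_apply, mul_smul_comm, smul_mul_assoc, ← smul_add]
    congr 2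
    have := h (x i) (x j) a
    simp only [br] at this
    rw [← sub_eq_zero, ← this]
    noncomm_ring
  obtain ⟨τ, hτ⟩ := exists_mvPolynomial_algHom (K := K) t t_comm
  have τ_central : ∀ u v (p : MvPolynomial ℕ K) a, τ p (br u v * a) = br u v * τ p a := by
    intro u v p
    induction p using MvPolynomial.induction_on with
    | C r =>
      intro a
      rw [← MvPolynomial.algebraMap_eq, AlgHom.commutes]
      simp
    | add p q hp hq => intro a; simp [hp, hq, mul_add]
    | mul_X p i hp =>
      intro a
      rw [map_mul τ, hτ, Module.End.mul_apply, Module.End.mul_apply, ← hp, t_apply, t_apply,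
        mul_smul_comm, mul_add, ← mul_assoc (x i), ← commute_br h u v (x i)]
      simp only [mul_assoc]
  let Ψ : Einf K ⊗[K] MvPolynomial ℕ K →ₗ[K] Q :=
    TensorProduct.lift (τ.toLinearMap.flip ∘ₗ c)
  have Ψ_tmul : ∀ w p, Ψ (w ⊗ₜ p) = τ p (c w) := fun _ _ => rfl
  have Ψ_X : ∀ i z, Ψ (1 ⊗ₜ MvPolynomial.X i * z) = t i (Ψ z) := by
    intro i z
    induction z with
    | zero => simp
    | add z₁ z₂ h₁ h₂ => rw [mul_add, map_add, map_add, map_add, h₁, h₂]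
    | tmul w p => simp [Ψ_tmul, hτ]
  have Ψ_ι : ∀ u v z, Ψ (ExteriorAlgebra.ι K u ⊗ₜ 1 * (ExteriorAlgebra.ι K v ⊗ₜ 1 * z)) =
      (1 / 2 : K) • (br (L u) (L v) * Ψ z) := by
    intro u v z
    induction z with
    | zero => simp
    | add z₁ z₂ h₁ h₂ => simp only [mul_add, map_add, h₁, h₂, smul_add]
    | tmul w p => simp [Ψ_tmul, c_mul, τ_central]
  have hL : ∀ i, L (Finsupp.single i 1) = x i := fun i => by simp [L]
  let H : FreeAlgebra K ℕ → Prop := fun g => Ψ (genericGrassmann K g) = π g ∧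
    ∀ v, Ψ (ExteriorAlgebra.ι K v ⊗ₜ 1 * genericGrassmann K g) = (1 / 2 : K) • br (L v) (π g)
  have H_one : H 1 := by
    constructor
    · rw [map_one (genericGrassmann K), map_one π, Algebra.TensorProduct.one_def, Ψ_tmul, c_one,
        map_one τ]
      rfl
    · intro v
      rw [map_one, map_one, mul_one, Ψ_tmul, c_ι]
      simp [br]
  have H_mul : ∀ f g, H g → H (f * g) := by
    intro f
    induction f with
    | grade0 r =>
      rintro g ⟨h₁, h₂⟩
      simp only [H, ← Algebra.smul_def, map_smul, h₁, mul_smul_comm, h₂, true_and]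
      intro v
      simp only [br, mul_smul_comm, smul_mul_assoc, ← smul_sub]
      rw [smul_comm]
    | mul a b ha hb => intro g hg; rw [mul_assoc]; exact ha _ (hb _ hg)
    | add a b ha hb =>
      intro g hg
      obtain ⟨a₁, a₂⟩ := ha g hg
      obtain ⟨b₁, b₂⟩ := hb g hg
      rw [add_mul]
      refine ⟨by rw [map_add, map_add, map_add, a₁, b₁], fun v => ?_⟩
      rw [map_add, map_add, mul_add, map_add, a₂, b₂, ← smul_add]
      simp only [br]
      congr 1
      noncomm_ring
    | grade1 i =>
      rintro g ⟨h₁, h₂⟩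
      have hg : genericGrassmann K (FreeAlgebra.ι K i * g) =
          ExteriorAlgebra.ι K (Finsupp.single i 1) ⊗ₜ 1 * genericGrassmann K g +
            1 ⊗ₜ MvPolynomial.X i * genericGrassmann K g := by
        rw [map_mul, ← add_mul]; simp [genericGrassmann]
      have hπ : π (FreeAlgebra.ι K i * g) = x i * π g := map_mul _ _ _
      constructor
      · rw [hg, hπ, map_add, Ψ_X, h₁, h₂, hL, t_apply, ← smul_add]
        have : br (x i) (π g) + (x i * π g + π g * x i) = (2 : K) • (x i * π g) := by
          rw [two_smul, br]; abel
        rw [this, smul_smul]; norm_num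
      · intro v
        have hswap : (ExteriorAlgebra.ι K v ⊗ₜ[K] (1 : MvPolynomial ℕ K)) *
            (1 ⊗ₜ MvPolynomial.X i * genericGrassmann K g) =
            1 ⊗ₜ MvPolynomial.X i * (ExteriorAlgebra.ι K v ⊗ₜ 1 * genericGrassmann K g) := by
          rw [← mul_assoc, ← mul_assoc]; simp
        rw [hg, hπ, mul_add, map_add, Ψ_ι, hswap, Ψ_X, h₁, h₂, hL, br_mul_right, t_apply,
          mul_smul_comm, smul_mul_assoc, commute_br h (L v) (π g) (x i), ← smul_add, ← two_smul K,
          smul_smul, smul_add, add_comm]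
        norm_num
  have := (H_mul f 1 H_one).1
  rw [mul_one, genericGrassmann_eq_zero K hf, map_zero] at this
  exact this.symm

/-- A two-sided ideal of the free algebra containing all commutators `[[a, b], c]` contains the
polynomial identities of the Grassmann algebra. -/
theorem mem_of_isPI_grassmann [CharZero K] (J : TwoSidedIdeal (FreeAlgebra K ℕ))
    (hJ : ∀ a b c, br (br a b) c ∈ J) {f : FreeAlgebra K ℕ} (hf : IsPI K (Einf K) f) : f ∈ J := by
  let π := J.ringCon.mkₐ (α := K)
  have hπ : ∀ a, π a = 0 ↔ a ∈ J := fun a => RingCon.eq J.ringCon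
  refine (hπ f).1 (algHom_eq_zero_of_isPI_grassmann ?_ π hf)
  intro a b c
  obtain ⟨a, rfl⟩ := RingCon.mkₐ_surjective (α := K) J.ringCon a
  obtain ⟨b, rfl⟩ := RingCon.mkₐ_surjective (α := K) J.ringCon b
  obtain ⟨c, rfl⟩ := RingCon.mkₐ_surjective (α := K) J.ringCon c
  have := (hπ _).2 (hJ a b c)
  simpa only [br, map_sub, map_mul] using this

end Grassmann

section FoxDerivative

variable (K : Type) [Field K]

/-- The substitution of `[[xⱼ, δᵢⱼ], [0, tⱼ]]` for `xⱼ`, with `tⱼ` polynomial variables. Its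
upper right entry is the Fox derivative with respect to `xᵢ`. -/
noncomputable def genericTriangular (i : ℕ) : FreeAlgebra K ℕ →ₐ[K]
    Matrix (Fin 2) (Fin 2) (FreeAlgebra K ℕ ⊗[K] MvPolynomial ℕ K) :=
  FreeAlgebra.lift K fun j =>
    !![FreeAlgebra.ι K j ⊗ₜ 1, if i = j then 1 else 0; 0, 1 ⊗ₜ MvPolynomial.X j]

/-- The projection of the free algebra onto the polynomial algebra. -/
noncomputable def toMvPolynomial : FreeAlgebra K ℕ →ₐ[K] MvPolynomial ℕ K :=
  FreeAlgebra.lift K MvPolynomial.X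

/-- The Fox derivative with respect to `xᵢ`, whose right coefficients are projected to the
polynomial algebra. -/
noncomputable def foxDeriv (i : ℕ) (f : FreeAlgebra K ℕ) :
    FreeAlgebra K ℕ ⊗[K] MvPolynomial ℕ K :=
  genericTriangular K i f 0 1

variable {K}

theorem genericTriangular_one_one (i : ℕ) (f : FreeAlgebra K ℕ) :
    genericTriangular K i f 1 0 = 0 ∧
      genericTriangular K i f 1 1 = 1 ⊗ₜ toMvPolynomial K f := by
  induction f with
  | grade0 r =>
    simp only [AlgHom.commutes, Matrix.algebraMap_matrix_apply]
    exact ⟨rfl, Algebra.TensorProduct.algebraMap_apply' r⟩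
  | grade1 j => simp [genericTriangular, toMvPolynomial]
  | mul a b ha hb => simp [Matrix.mul_apply, Fin.sum_univ_two, ha, hb]
  | add a b ha hb => simp [ha, hb, TensorProduct.tmul_add]

theorem foxDeriv_add (i : ℕ) (f g : FreeAlgebra K ℕ) :
    foxDeriv K i (f + g) = foxDeriv K i f + foxDeriv K i g := by
  simp [foxDeriv]

theorem foxDeriv_algebraMap_mul (i : ℕ) (r : K) (f : FreeAlgebra K ℕ) :
    foxDeriv K i (algebraMap K _ r * f) = r • foxDeriv K i f := by
  rw [← Algebra.smul_def]
  simp [foxDeriv]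

theorem foxDeriv_ι_mul (i j : ℕ) (f : FreeAlgebra K ℕ) :
    foxDeriv K i (FreeAlgebra.ι K j * f) = FreeAlgebra.ι K j ⊗ₜ 1 * foxDeriv K i f +
      if i = j then 1 ⊗ₜ toMvPolynomial K f else 0 := by
  rw [foxDeriv, map_mul, Matrix.mul_apply, Fin.sum_univ_two, (genericTriangular_one_one i f).2]
  simp [genericTriangular, foxDeriv]

/-- The product of the variables prescribed by `m`, in increasing order. -/
noncomputable def orderedMonomial (K : Type) [Field K] (m : ℕ →₀ ℕ) : FreeAlgebra K ℕ :=
  ((m.toMultiset.sort (· ≤ ·)).map (FreeAlgebra.ι K)).prod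

/-- The linear section of `toMvPolynomial` given by ordered monomials. -/
noncomputable def orderedLift (K : Type) [Field K] : MvPolynomial ℕ K →ₗ[K] FreeAlgebra K ℕ :=
  (MvPolynomial.basisMonomials ℕ K).constr K (orderedMonomial K)

theorem orderedLift_monomial (m : ℕ →₀ ℕ) :
    orderedLift K (MvPolynomial.monomial m 1) = orderedMonomial K m := by
  simpa [orderedLift] using
    (MvPolynomial.basisMonomials ℕ K).constr_basis K (orderedMonomial K) m

theorem orderedLift_one : orderedLift K 1 = 1 := by
  have := orderedLift_monomial (K := K) 0
  rw [← MvPolynomial.C_apply, map_one] at this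
  simpa [orderedMonomial] using this

/-- The linear map `a ⊗ p ↦ a (xᵢ σ(p) - σ(xᵢ p))` where `σ` is `orderedLift`. -/
noncomputable def foxIntegral (K : Type) [Field K] (i : ℕ) :
    FreeAlgebra K ℕ ⊗[K] MvPolynomial ℕ K →ₗ[K] FreeAlgebra K ℕ :=
  TensorProduct.lift ((LinearMap.mul K (FreeAlgebra K ℕ)).compl₂
    (LinearMap.mulLeft K (FreeAlgebra.ι K i) ∘ₗ orderedLift K -
      orderedLift K ∘ₗ LinearMap.mulLeft K (MvPolynomial.X i)))

theorem foxIntegral_tmul (i : ℕ) (a : FreeAlgebra K ℕ) (p : MvPolynomial ℕ K) :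
    foxIntegral K i (a ⊗ₜ p) =
      a * (FreeAlgebra.ι K i * orderedLift K p - orderedLift K (MvPolynomial.X i * p)) := rfl

theorem foxIntegral_tmul_one_mul (i : ℕ) (a : FreeAlgebra K ℕ)
    (z : FreeAlgebra K ℕ ⊗[K] MvPolynomial ℕ K) :
    foxIntegral K i (a ⊗ₜ 1 * z) = a * foxIntegral K i z := by
  induction z with
  | zero => simp
  | add z₁ z₂ h₁ h₂ => rw [mul_add, map_add, map_add, mul_add, h₁, h₂]
  | tmul b p => simp [foxIntegral_tmul, mul_assoc]

/-- The fundamental formula of Fox calculus: a noncommutative polynomial is recovered from its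
image in the polynomial algebra and its Fox derivatives. -/
theorem exists_sub_orderedLift_eq_sum_foxIntegral (f : FreeAlgebra K ℕ) :
    ∃ s : Finset ℕ, ∀ s', s ⊆ s' → f - orderedLift K (toMvPolynomial K f) =
      ∑ i ∈ s', foxIntegral K i (foxDeriv K i f) := by
  let H : FreeAlgebra K ℕ → Prop := fun f => ∃ s : Finset ℕ, ∀ s', s ⊆ s' →
    f - orderedLift K (toMvPolynomial K f) = ∑ i ∈ s', foxIntegral K i (foxDeriv K i f)
  have H_one : H 1 := ⟨∅, fun s' _ => by simp [foxDeriv, orderedLift_one]⟩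
  have H_mul : ∀ f g, H g → H (f * g) := by
    intro f
    induction f with
    | grade0 r =>
      rintro g ⟨s, hs⟩
      refine ⟨s, fun s' h => ?_⟩
      simp only [foxDeriv_algebraMap_mul, map_smul, ← Finset.smul_sum, ← hs s' h]
      simp only [← Algebra.smul_def, map_smul, smul_sub]
    | mul a b ha hb => intro g hg; rw [mul_assoc]; exact ha _ (hb _ hg)
    | add a b ha hb =>
      intro g hg
      obtain ⟨s, hs⟩ := ha g hg
      obtain ⟨t, ht⟩ := hb g hg
      refine ⟨s ∪ t, fun s' h => ?_⟩
      simp only [add_mul, foxDeriv_add, map_add, Finset.sum_add_distrib,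
        ← hs s' (Finset.union_subset_left h), ← ht s' (Finset.union_subset_right h)]
      abel
    | grade1 j =>
      rintro g ⟨s, hs⟩
      refine ⟨insert j s, fun s' h => ?_⟩
      have hj : j ∈ s' := h (Finset.mem_insert_self _ _)
      have hx : toMvPolynomial K (FreeAlgebra.ι K j) = MvPolynomial.X j := by
        simp [toMvPolynomial]
      have hterm : ∀ i, foxIntegral K i (foxDeriv K i (FreeAlgebra.ι K j * g)) =
          FreeAlgebra.ι K j * foxIntegral K i (foxDeriv K i g) + if i = j then
            foxIntegral K i (1 ⊗ₜ toMvPolynomial K g) else 0 := fun i => by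
        rw [foxDeriv_ι_mul, map_add, foxIntegral_tmul_one_mul]
        split_ifs <;> simp
      simp only [hterm, Finset.sum_add_distrib, ← Finset.mul_sum,
        ← hs s' ((Finset.subset_insert _ _).trans h), Finset.sum_ite_eq', hj, if_true,
        foxIntegral_tmul, map_mul, hx]
      noncomm_ring
  simpa [H] using H_mul f 1 H_one

theorem prod_map_sub_prod_map_mem {R : Type} [Ring R] (J : TwoSidedIdeal R)
    (hJ : ∀ a b, br a b ∈ J) {l₁ l₂ : List ℕ} (h : l₁.Perm l₂) (x : ℕ → R) :
    (l₁.map x).prod - (l₂.map x).prod ∈ J := by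
  induction h with
  | nil => simp
  | cons a _ ih => simpa [mul_sub] using J.mul_mem_left (x a) _ ih
  | swap a b l =>
    simpa [br, sub_mul, mul_assoc] using J.mul_mem_right _ (l.map x).prod (hJ (x b) (x a))
  | trans _ _ h₁ h₂ => simpa using J.add_mem h₁ h₂

theorem ι_mul_orderedLift_sub_mem (J : TwoSidedIdeal (FreeAlgebra K ℕ))
    (hJ : ∀ a b, br a b ∈ J) (i : ℕ) (m : ℕ →₀ ℕ) :
    FreeAlgebra.ι K i * orderedLift K (MvPolynomial.monomial m 1) -
      orderedLift K (MvPolynomial.X i * MvPolynomial.monomial m 1) ∈ J := by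
  have hX : (MvPolynomial.X i * MvPolynomial.monomial m 1 : MvPolynomial ℕ K) =
      MvPolynomial.monomial (Finsupp.single i 1 + m) 1 := by
    rw [MvPolynomial.X, MvPolynomial.monomial_mul, one_mul]
  rw [hX, orderedLift_monomial, orderedLift_monomial, orderedMonomial, orderedMonomial,
    ← List.prod_cons, ← List.map_cons]
  refine prod_map_sub_prod_map_mem J hJ ?_ _
  rw [← Multiset.coe_eq_coe, ← Multiset.cons_coe, Multiset.sort_eq, Multiset.sort_eq, map_add,
    Finsupp.toMultiset_single, one_smul, Multiset.singleton_add]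

end FoxDerivative

section UpperTriangular

variable {K : Type} [Field K]

theorem commute_of_mem_evenPart_s19 {V : Type} [AddCommGroup V] [Module K V]
    {a : ExteriorAlgebra K V} (ha : a ∈ evenPart K V) (b : ExteriorAlgebra K V) :
    a * b = b * a := by
  have hι : ∀ u v : V, ExteriorAlgebra.ι K u * ExteriorAlgebra.ι K v =
      -(ExteriorAlgebra.ι K v * ExteriorAlgebra.ι K u) := fun u v =>
    eq_neg_of_add_eq_zero_left (ExteriorAlgebra.ι_add_mul_swap u v)
  induction b using ExteriorAlgebra.induction with
  | algebraMap r => exact (Algebra.commutes r a).symm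
  | mul b c hb hc => rw [← mul_assoc, hb, mul_assoc, hc, mul_assoc]
  | add b c hb hc => rw [mul_add, add_mul, hb, hc]
  | ι v =>
    induction a, ha using CliffordAlgebra.even_induction with
    | algebraMap r => exact Algebra.commutes r _
    | add x y _ _ hx hy => rw [add_mul, mul_add, hx, hy]
    | ι_mul_ι_mul m₁ m₂ x _ hx =>
      change ExteriorAlgebra.ι K m₁ * ExteriorAlgebra.ι K m₂ * x * _ =
        _ * (ExteriorAlgebra.ι K m₁ * ExteriorAlgebra.ι K m₂ * x)
      rw [mul_assoc, hx, ← mul_assoc, mul_assoc (ExteriorAlgebra.ι K m₁), hι m₂ v, mul_neg,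
        ← mul_assoc, hι m₁ v]
      noncomm_ring

theorem br_mem_evenPart {V : Type} [AddCommGroup V] [Module K V] (a b : ExteriorAlgebra K V) :
    br a b ∈ evenPart K V := by
  have hdecomp : ∀ a : ExteriorAlgebra K V,
      ∃ x ∈ evenPart K V, ∃ y ∈ oddPart K V, x + y = a := fun a => by
    have := (CliffordAlgebra.evenOdd_isCompl (0 : QuadraticForm K V)).sup_eq_top
    exact Submodule.mem_sup.1 (this ▸ Submodule.mem_top : a ∈ _ ⊔ _)
  obtain ⟨a₀, ha₀, a₁, ha₁, rfl⟩ := hdecomp a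
  obtain ⟨b₀, hb₀, b₁, hb₁, rfl⟩ := hdecomp b
  have : br (a₀ + a₁) (b₀ + b₁) = a₁ * b₁ - b₁ * a₁ := by
    rw [br, add_mul, mul_add, mul_add, add_mul, mul_add, mul_add,
      commute_of_mem_evenPart_s19 ha₀ b₀, commute_of_mem_evenPart_s19 ha₀ b₁,
      commute_of_mem_evenPart_s19 hb₀ a₁]
    abel
  rw [this]
  exact Submodule.sub_mem _ (oddPart_mul_mem_even K V ha₁ hb₁) (oddPart_mul_mem_even K V hb₁ ha₁)

theorem br_br_mul_br_eq_zero_of_algA' {V : Type} [AddCommGroup V] [Module K V]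
    (a b c d e : algA' K V) : br (br a b) c * br d e = 0 := by
  obtain ⟨a, ha, ha'⟩ := a
  obtain ⟨b, hb, hb'⟩ := b
  obtain ⟨c, hc, hc'⟩ := c
  obtain ⟨d, hd, hd'⟩ := d
  obtain ⟨e, he, he'⟩ := e
  apply Subtype.ext
  have h₁ : br (br (a 0 0) (b 0 0)) (c 0 0) = 0 :=
    sub_eq_zero.2 (commute_of_mem_evenPart_s19 (br_mem_evenPart _ _) _)
  have h₂ : ∀ {x}, x ∈ evenPart K V → ∀ y, x * y - y * x = 0 := fun hx y =>
    sub_eq_zero.2 (commute_of_mem_evenPart_s19 hx y)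
  simp only [br] at h₁ ⊢
  change ((a * b - b * a) * c - c * (a * b - b * a)) * (d * e - e * d) = 0
  ext i j
  fin_cases i <;> fin_cases j <;>
    simp [Matrix.mul_apply, Fin.sum_univ_two, ha', hb', hc', hd', he', h₁, h₂ ha, h₂ hd]

theorem evalPolyTensor_genericTriangular_of_isPI {f : FreeAlgebra K ℕ}
    (hf : IsPI K (algA' K (ℕ →₀ K)) f) (i : ℕ) (φ : FreeAlgebra K ℕ →ₐ[K] Einf K) (β : ℕ → K) :
    (evalPolyTensor φ β).mapMatrix (genericTriangular K i f) = 0 := by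
  let ψ : FreeAlgebra K ℕ →ₐ[K] algA' K (ℕ →₀ K) := FreeAlgebra.lift K fun j =>
    ⟨!![φ (FreeAlgebra.ι K j), if i = j then 1 else 0; 0, algebraMap K _ (β j)],
      evenPart_algebraMap_mem K _ (β j), rfl⟩
  have h : (algA' K (ℕ →₀ K)).val.comp ψ =
      (evalPolyTensor φ β).mapMatrix.comp (genericTriangular K i) := by
    ext j : 2
    ext k l
    fin_cases k <;> fin_cases l <;>
      simp [ψ, genericTriangular, evalPolyTensor_tmul, apply_ite,
        Algebra.algebraMap_eq_smul_one]
  have := DFunLike.congr_fun h f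
  simpa [hf ψ] using this.symm

theorem toMvPolynomial_eq_zero_of_isPI [Infinite K] {f : FreeAlgebra K ℕ}
    (hf : IsPI K (algA' K (ℕ →₀ K)) f) : toMvPolynomial K f = 0 := by
  refine MvPolynomial.funext fun β => ?_
  have h := congrFun (congrFun (evalPolyTensor_genericTriangular_of_isPI hf 0
    (FreeAlgebra.lift K 0) β) 1) 1
  simpa [(genericTriangular_one_one 0 f).2, evalPolyTensor_tmul] using h

theorem mem_of_isPI_algA' [CharZero K] (I : TwoSidedIdeal (FreeAlgebra K ℕ))
    (hI : ∀ a b c d e, br (br a b) c * br d e ∈ I) {f : FreeAlgebra K ℕ}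
    (hf : IsPI K (algA' K (ℕ →₀ K)) f) : f ∈ I := by
  let J₁ : TwoSidedIdeal (FreeAlgebra K ℕ) := TwoSidedIdeal.mk'
    {a | ∀ u v w, a * u * br v w ∈ I}
    (fun u v w => by simp)
    (fun ha hb u v w => by simpa [add_mul] using I.add_mem (ha u v w) (hb u v w))
    (fun ha u v w => by simpa using I.neg_mem (ha u v w))
    (fun ha u v w => by simpa [mul_assoc] using I.mul_mem_left _ _ (ha u v w))
    (fun {x y} ha u v w => by simpa [mul_assoc] using ha (y * u) v w)
  have mem_J₁ : ∀ a, a ∈ J₁ ↔ ∀ u v w, a * u * br v w ∈ I := fun a => TwoSidedIdeal.mem_mk' ..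
  let J₂ : TwoSidedIdeal (FreeAlgebra K ℕ) := TwoSidedIdeal.mk'
    {g | ∀ a ∈ J₁, a * g ∈ I}
    (fun a _ => by simp)
    (fun hg hh a ha => by simpa [mul_add] using I.add_mem (hg a ha) (hh a ha))
    (fun hg a ha => by simpa using I.neg_mem (hg a ha))
    (fun {x y} hg a ha => by simpa [mul_assoc] using hg (a * x) (J₁.mul_mem_right _ _ ha))
    (fun {x y} hg a ha => by simpa [mul_assoc] using I.mul_mem_right _ y (hg a ha))
  have mem_J₂ : ∀ g, g ∈ J₂ ↔ ∀ a ∈ J₁, a * g ∈ I := fun g => TwoSidedIdeal.mem_mk' ..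
  have hJ₁ : ∀ a b c, br (br a b) c ∈ J₁ := by
    intro a b c
    rw [mem_J₁]
    intro u v w
    have e : br (br a b) c * u * br v w =
        br (br a b) c * br (u * v) w - br (br a b) c * br u w * v := by
      simp only [br]; noncomm_ring
    rw [e]
    exact I.sub_mem (hI _ _ _ _ _) (I.mul_mem_right _ _ (hI _ _ _ _ _))
  have hJ₂ : ∀ a b, br a b ∈ J₂ := by
    intro v w
    rw [mem_J₂]
    intro a ha
    simpa using (mem_J₁ a).1 ha 1 v w
  obtain ⟨s, hs⟩ := exists_sub_orderedLift_eq_sum_foxIntegral f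
  have hf' := hs s subset_rfl
  rw [toMvPolynomial_eq_zero_of_isPI hf, map_zero, sub_zero] at hf'
  rw [hf']
  refine sum_mem fun i _ => ?_
  obtain ⟨b, hb⟩ := exists_eq_sum_tmul_monomial (foxDeriv K i f)
  have hcoeff : ∀ m, b m ∈ J₁ := fun m => mem_of_isPI_grassmann J₁ hJ₁ fun φ => by
    refine map_coeff_eq_zero_of_evalPolyTensor φ (fun β => ?_) m
    rw [← hb]
    exact congrFun (congrFun (evalPolyTensor_genericTriangular_of_isPI hf i φ β) 0) 1
  rw [hb, Finsupp.sum, map_sum]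
  refine sum_mem fun m _ => ?_
  rw [foxIntegral_tmul]
  exact (mem_J₂ _).1 (ι_mul_orderedLift_sub_mem J₂ hJ₂ i m) _ (hcoeff m)

end UpperTriangular

/-- The T-ideal of polynomial identities of the algebra `A′` is generated
as a T-ideal by `[x₁,x₂,x₃][x₄,x₅]`. -/
theorem tideal_algA'_eq_gen (K : Type) [Field K] [CharZero K] :
    TId K (↥(algA' K (ℕ →₀ K))) =
      TIdealGen K {br (br (xv K 1) (xv K 2)) (xv K 3) * br (xv K 4) (xv K 5)} := by
  ext f
  constructor
  · intro hf I hI hgen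
    refine mem_of_isPI_algA' I (fun a b c d e => ?_) hf
    have := hI (FreeAlgebra.lift K fun i =>
      if i = 1 then a else if i = 2 then b else if i = 3 then c else if i = 4 then d else e) _
      (hgen rfl)
    simpa [br, xv] using this
  · intro hf φ
    let I : TwoSidedIdeal (FreeAlgebra K ℕ) := TwoSidedIdeal.mk'
      {f | IsPI K (algA' K (ℕ →₀ K)) f}
      (fun φ => map_zero φ)
      (fun hx hy φ => by rw [map_add, hx φ, hy φ, add_zero])
      (fun hx φ => by rw [map_neg, hx φ, neg_zero])
      (fun hy φ => by rw [map_mul, hy φ, mul_zero])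
      (fun hx φ => by rw [map_mul, hx φ, zero_mul])
    have mem_I : ∀ f, f ∈ I ↔ IsPI K (algA' K (ℕ →₀ K)) f := fun f => TwoSidedIdeal.mem_mk' ..
    refine (mem_I f).1 (hf I ?_ ?_) φ
    · intro ψ f hf
      rw [mem_I] at hf ⊢
      exact fun φ => hf (φ.comp ψ)
    · rintro _ rfl
      refine (mem_I _).2 fun φ => ?_
      rw [map_mul]
      simp only [br, map_sub, map_mul]
      exact br_br_mul_br_eq_zero_of_algA' _ _ _ _ _
end
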